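/- arXiv:2302.05295 — 2 statements merged into one kernel-verified Lean document; each statement's English description precedes it below -/
import Mathlib

section
/- For even N ≥ 2 and any l with 2 ≤ l ≤ N/2, let e_{[N]} = e_1∧…∧e_N and e_{[N−2l]} = e_1∧…∧e_{N−2l} in ⋀E (with e_{[0]} := 1). Then the kernel H = {v ∈ V : v · (e_{[N]} + e_{[N−2l]}) = 0} of Clifford multiplication equals span(e_1,…,e_{N−2l}); in particular dim H = N − 2l. For l = 1 instead, the kernel strictly contains span(e_1,…,e_{N−2}) and equals span(e_1,…,e_{N−2}, e_{N−1}+f_N, e_N−f_{N−1}), of dimension N. -/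
/- Formalization of a statement about spinor varieties (Galgano, arXiv:2302.05295). -/

noncomputable section
open CliffordAlgebra

/-- The model for the maximal isotropic subspace `E`. -/
abbrev Evec (N : ℕ) := Fin N → ℂ

/-- The model for `V = E ⊕ E^∨`: a pair `(e, f)` represents `∑ eᵢ • eᵢ + ∑ fᵢ • fᵢ`. -/
abbrev Vsp (N : ℕ) := (Fin N → ℂ) × (Fin N → ℂ)

/-- The exterior algebra `⋀ E` hosting the (sums of half-) spin representations. -/
abbrev ExtE (N : ℕ) := ExteriorAlgebra ℂ (Evec N)

/-- `b ↦ (a ↦ ∑ aᵢ bᵢ)`, identifying `E` with its dual. -/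
def toDualMap (N : ℕ) : Evec N →ₗ[ℂ] Module.Dual ℂ (Evec N) where
  toFun b := ∑ i, b i • LinearMap.proj i
  map_add' x y := by simp [add_smul, Finset.sum_add_distrib]
  map_smul' c x := by simp [smul_smul, Finset.smul_sum]

/-- Clifford multiplication on the spinor module `⋀E` by an element
`v = (e, f) ∈ V = E ⊕ E^∨`: wedge by `e` plus contraction by `f`; bundled as a
linear map in `v`, for a fixed spinor `x`.  `psi x v = v ⋅ x`. -/
def psi {N : ℕ} (x : ExtE N) : Vsp N →ₗ[ℂ] ExtE N :=
  (LinearMap.mulRight ℂ x).comp ((ExteriorAlgebra.ι ℂ).comp (LinearMap.fst ℂ _ _)) +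
  ((CliffordAlgebra.contractLeft (Q := (0 : QuadraticForm ℂ (Evec N)))).flip x).comp
    ((toDualMap N).comp (LinearMap.snd ℂ _ _))

/-- The wedge product `e_I = e_{i₁} ∧ ⋯ ∧ e_{i_k}` over the sorted index set `I`. -/
def eI {N : ℕ} (I : Finset (Fin N)) : ExtE N :=
  ((I.sort (· ≤ ·)).map (fun i => ExteriorAlgebra.ι ℂ (Pi.single i 1))).prod

open ExteriorAlgebra in
theorem psi_apply {N : ℕ} (x : ExtE N) (v : Vsp N) :
    psi x v = ι ℂ v.1 * x + contractLeft (Q := (0 : QuadraticForm ℂ (Evec N)))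
      (toDualMap N v.2) x := rfl

theorem toDualMap_apply {N : ℕ} (b a : Evec N) : toDualMap N b a = ∑ i, b i * a i := by
  simp [toDualMap]

theorem contractLeft_ι_mul_exterior {N : ℕ} (d : Module.Dual ℂ (Evec N)) (a : Evec N)
    (x : ExtE N) :
    contractLeft (Q := (0 : QuadraticForm ℂ (Evec N))) d (ExteriorAlgebra.ι ℂ a * x) =
      d a • x - ExteriorAlgebra.ι ℂ a *
        contractLeft (Q := (0 : QuadraticForm ℂ (Evec N))) d x :=
  CliffordAlgebra.contractLeft_ι_mul (Q := (0 : QuadraticForm ℂ (Evec N))) d a x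

theorem ι_mul_ι_mul_anticomm {N : ℕ} (a b : Evec N) (x : ExtE N) :
    ExteriorAlgebra.ι ℂ a * (ExteriorAlgebra.ι ℂ b * x) =
      -(ExteriorAlgebra.ι ℂ b * (ExteriorAlgebra.ι ℂ a * x)) := by
  rw [eq_neg_iff_add_eq_zero, ← mul_assoc, ← mul_assoc, ← add_mul,
    ExteriorAlgebra.ι_add_mul_swap, zero_mul]

/-- The Clifford relation for the polarization of `q`. -/
theorem psi_psi_add_swap {N : ℕ} (x : ExtE N) (v w : Vsp N) :
    psi (psi x v) w + psi (psi x w) v =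
      (toDualMap N w.2 v.1 + toDualMap N v.2 w.1) • x := by
  simp only [psi_apply, map_add, mul_add, contractLeft_ι_mul_exterior]
  rw [ι_mul_ι_mul_anticomm w.1 v.1, contractLeft_comm (toDualMap N w.2) (toDualMap N v.2), add_smul]
  abel

/-- The kernel of Clifford multiplication on a nonzero spinor is isotropic. -/
theorem isotropic_of_mem_ker_psi {N : ℕ} {x : ExtE N} (hx : x ≠ 0) {v w : Vsp N}
    (hv : psi x v = 0) (hw : psi x w = 0) :
    toDualMap N w.2 v.1 + toDualMap N v.2 w.1 = 0 := by
  have h := psi_psi_add_swap x v w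
  rw [hv, hw] at h
  simpa [psi_apply, hx] using h.symm

/-- The wedge product of standard basis vectors along a list. -/
def wedgeList {N : ℕ} (l : List (Fin N)) : ExtE N :=
  (l.map fun i => ExteriorAlgebra.ι ℂ (Pi.single i 1)).prod

theorem wedgeList_cons {N : ℕ} (i : Fin N) (l : List (Fin N)) :
    wedgeList (i :: l) = ExteriorAlgebra.ι ℂ (Pi.single i 1) * wedgeList l := by
  simp [wedgeList]

theorem contractLeft_wedgeList {N : ℕ} (d : Module.Dual ℂ (Evec N)) (l : List (Fin N))
    (hd : ∀ i ∈ l, d (Pi.single i 1) = 0) :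
    contractLeft (Q := (0 : QuadraticForm ℂ (Evec N))) d (wedgeList l) = 0 := by
  induction l with
  | nil => simp [wedgeList]
  | cons h t ih =>
    rw [wedgeList_cons, contractLeft_ι_mul_exterior, ih fun i hi => hd i (by simp [hi]),
      hd h (by simp)]
    simp

theorem ι_single_mul_wedgeList {N : ℕ} {i : Fin N} {l : List (Fin N)} (hi : i ∈ l) :
    ExteriorAlgebra.ι ℂ (Pi.single i (1 : ℂ)) * wedgeList l = 0 := by
  induction l with
  | nil => simp at hi
  | cons h t ih =>
    rw [wedgeList_cons]
    rcases List.mem_cons.1 hi with rfl | ht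
    · rw [← mul_assoc, ExteriorAlgebra.ι_sq_zero, zero_mul]
    · rw [ι_mul_ι_mul_anticomm, ih ht, mul_zero, neg_zero]

theorem toDualMap_single {N : ℕ} (i j : Fin N) :
    toDualMap N (Pi.single i 1) (Pi.single j 1) = if i = j then 1 else 0 := by
  simp [toDualMap_apply, Pi.single_apply, eq_comm]

theorem toDualMap_single_left {N : ℕ} (i : Fin N) (a : Evec N) :
    toDualMap N (Pi.single i 1) a = a i := by
  simp [toDualMap_apply, Pi.single_apply]

theorem toDualMap_single_right {N : ℕ} (i : Fin N) (b : Evec N) :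
    toDualMap N b (Pi.single i 1) = b i := by
  simp [toDualMap_apply, Pi.single_apply]

theorem wedgeList_ne_zero {N : ℕ} {l : List (Fin N)} (hl : l.Nodup) : wedgeList l ≠ 0 := by
  induction l with
  | nil => simp [wedgeList]
  | cons h t ih =>
    obtain ⟨hh, ht⟩ := List.nodup_cons.1 hl
    intro h0
    apply ih ht
    have h1 := congrArg (contractLeft (Q := (0 : QuadraticForm ℂ (Evec N)))
      (toDualMap N (Pi.single h 1))) h0
    rw [wedgeList_cons, contractLeft_ι_mul_exterior, contractLeft_wedgeList _ t] at h1
    · simpa [toDualMap_single] using h1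
    · intro i hi
      rw [toDualMap_single, if_neg]
      rintro rfl
      exact hh hi

theorem wedgeList_append_pair {N : ℕ} (l : List (Fin N)) (p q : Fin N) :
    wedgeList (l ++ [p, q]) = ExteriorAlgebra.ι ℂ (Pi.single p 1) *
      (ExteriorAlgebra.ι ℂ (Pi.single q 1) * wedgeList l) := by
  induction l with
  | nil => simp [wedgeList]
  | cons h t ih =>
    rw [List.cons_append, wedgeList_cons, wedgeList_cons, ih, ι_mul_ι_mul_anticomm,
      ι_mul_ι_mul_anticomm (Pi.single h 1), mul_neg, neg_neg]

theorem eI_eq_wedgeList {N : ℕ} (I : Finset (Fin N)) : eI I = wedgeList (I.sort (· ≤ ·)) := rfl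

theorem eI_ne_zero {N : ℕ} (I : Finset (Fin N)) : eI I ≠ 0 :=
  wedgeList_ne_zero (I.sort_nodup _)

theorem ι_single_mul_eI {N : ℕ} {i : Fin N} {I : Finset (Fin N)} (hi : i ∈ I) :
    ExteriorAlgebra.ι ℂ (Pi.single i (1 : ℂ)) * eI I = 0 :=
  ι_single_mul_wedgeList (by simpa using hi)

theorem contractLeft_eI {N : ℕ} {b : Evec N} {I : Finset (Fin N)} (hb : ∀ i ∈ I, b i = 0) :
    contractLeft (Q := (0 : QuadraticForm ℂ (Evec N))) (toDualMap N b) (eI I) = 0 :=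
  contractLeft_wedgeList _ _ fun i hi => by
    rw [toDualMap_single_right]; exact hb i (by simpa using hi)

theorem ι_mul_eI_univ {N : ℕ} (a : Evec N) :
    ExteriorAlgebra.ι ℂ a * eI (Finset.univ : Finset (Fin N)) = 0 := by
  rw [pi_eq_sum_univ' a]
  simp only [map_sum, map_smul, Finset.sum_mul, smul_mul_assoc]
  refine Finset.sum_eq_zero fun i _ => ?_
  have := ι_single_mul_eI (Finset.mem_univ i)
  simp_all [Pi.single]

theorem ι_single_mul_contractLeft_eI_univ {N : ℕ} (b : Evec N) (j : Fin N) :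
    ExteriorAlgebra.ι ℂ (Pi.single j 1) *
      contractLeft (Q := (0 : QuadraticForm ℂ (Evec N))) (toDualMap N b) (eI Finset.univ) =
      b j • eI Finset.univ := by
  have h := contractLeft_ι_mul_exterior (toDualMap N b) (Pi.single j 1) (eI Finset.univ)
  rw [ι_mul_eI_univ, map_zero, toDualMap_single_right] at h
  exact (sub_eq_zero.1 h.symm).symm

theorem contractLeft_single_ι_mul_eI {N : ℕ} {I : Finset (Fin N)} {i : Fin N} (hi : i ∉ I)
    (a : Evec N) :
    contractLeft (Q := (0 : QuadraticForm ℂ (Evec N))) (toDualMap N (Pi.single i 1))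
      (ExteriorAlgebra.ι ℂ a * eI I) = a i • eI I := by
  rw [contractLeft_ι_mul_exterior, contractLeft_eI, mul_zero, sub_zero, toDualMap_single_left]
  intro j hj
  exact Pi.single_eq_of_ne (by rintro rfl; exact hi hj) _

theorem eI_univ_add_eI_ne_zero {N : ℕ} {I : Finset (Fin N)} {i : Fin N} (hi : i ∉ I) :
    eI Finset.univ + eI I ≠ 0 := by
  intro h
  have h1 := congrArg (ExteriorAlgebra.ι ℂ (Pi.single i (1 : ℂ)) * ·) h
  simp only [mul_add, ι_mul_eI_univ, zero_add, mul_zero] at h1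
  have h2 := contractLeft_single_ι_mul_eI hi (Pi.single i 1)
  rw [h1, map_zero] at h2
  exact eI_ne_zero I (by simpa using h2.symm)

theorem psi_eI_single {N : ℕ} {I : Finset (Fin N)} {i : Fin N} (hi : i ∈ I) :
    psi (eI Finset.univ + eI I) (Pi.single i 1, 0) = 0 := by
  simp [psi_apply, mul_add, ι_mul_eI_univ, ι_single_mul_eI hi]

theorem snd_apply_eq_zero_of_psi_eI {N : ℕ} {I : Finset (Fin N)} {k : Fin N} (hk : k ∉ I)
    {v : Vsp N} (hv : psi (eI Finset.univ + eI I) v = 0) {i : Fin N} (hi : i ∈ I) :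
    v.2 i = 0 := by
  simpa [toDualMap_single_right] using
    isotropic_of_mem_ker_psi (eI_univ_add_eI_ne_zero hk) hv (psi_eI_single hi)

theorem psi_eI_of_snd {N : ℕ} {I : Finset (Fin N)} {v : Vsp N} (hv : ∀ i ∈ I, v.2 i = 0) :
    psi (eI Finset.univ + eI I) v = ExteriorAlgebra.ι ℂ v.1 * eI I +
      contractLeft (Q := (0 : QuadraticForm ℂ (Evec N))) (toDualMap N v.2)
        (eI Finset.univ) := by
  rw [psi_apply, mul_add, map_add, ι_mul_eI_univ, contractLeft_eI hv, zero_add, add_zero]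

theorem fst_apply_eq_zero_of_psi_eI {N : ℕ} {I : Finset (Fin N)}
    (hI : ∀ i ∉ I, ∃ j ∉ I, ∃ k ∉ I, j ≠ i ∧ k ≠ i ∧ k ≠ j) {v : Vsp N}
    (hb : ∀ i ∈ I, v.2 i = 0) (hv : psi (eI Finset.univ + eI I) v = 0) {i : Fin N}
    (hi : i ∉ I) : v.1 i = 0 := by
  obtain ⟨j, hj, k, hk, hji, hki, hkj⟩ := hI i hi
  rw [psi_eI_of_snd hb] at hv
  have h1 := congrArg (fun y => ExteriorAlgebra.ι ℂ (Pi.single k (1 : ℂ)) *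
    (ExteriorAlgebra.ι ℂ (Pi.single j (1 : ℂ)) * y)) hv
  simp only [mul_add, ι_single_mul_contractLeft_eI_univ, mul_smul_comm, ι_mul_eI_univ,
    smul_zero, add_zero, mul_zero] at h1
  have h2 := congrArg (contractLeft (Q := (0 : QuadraticForm ℂ (Evec N)))
    (toDualMap N (Pi.single i 1))) h1
  simp only [contractLeft_ι_mul_exterior _ (Pi.single k 1),
    contractLeft_ι_mul_exterior _ (Pi.single j 1), contractLeft_single_ι_mul_eI hi,
    toDualMap_single, if_neg hji.symm, if_neg hki.symm, zero_smul, zero_sub, mul_neg,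
    neg_neg, mul_smul_comm, map_zero] at h2
  have h3 := congrArg (contractLeft (Q := (0 : QuadraticForm ℂ (Evec N)))
    (toDualMap N (Pi.single k 1))) h2
  rw [map_smul, contractLeft_ι_mul_exterior, contractLeft_single_ι_mul_eI hk,
    Pi.single_eq_of_ne hkj] at h3
  simp only [toDualMap_single, if_true, one_smul, zero_smul, mul_zero, sub_zero, map_zero] at h3
  have h4 := congrArg (contractLeft (Q := (0 : QuadraticForm ℂ (Evec N)))
    (toDualMap N (Pi.single j 1))) h3
  rw [map_smul, contractLeft_single_ι_mul_eI hj, map_zero] at h4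
  simpa [eI_ne_zero] using h4

theorem snd_eq_zero_of_contractLeft_eI_univ {N : ℕ} {b : Evec N}
    (hb : contractLeft (Q := (0 : QuadraticForm ℂ (Evec N))) (toDualMap N b)
      (eI Finset.univ) = 0) : b = 0 := by
  funext j
  have h := ι_single_mul_contractLeft_eI_univ b j
  rw [hb, mul_zero] at h
  simpa [eI_ne_zero] using h.symm

/-- If `I` omits at least three indices, only the `e_i` with `i ∈ I` annihilate
`e_{[N]} + e_I`. -/
theorem ker_psi_eI_univ_add {N : ℕ} {I : Finset (Fin N)} (hne : ∃ k, k ∉ I)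
    (hI : ∀ i ∉ I, ∃ j ∉ I, ∃ k ∉ I, j ≠ i ∧ k ≠ i ∧ k ≠ j) :
    LinearMap.ker (psi (eI Finset.univ + eI I)) =
      Submodule.span ℂ (Set.range fun i : I => ((Pi.single i.1 1, 0) : Vsp N)) := by
  obtain ⟨k, hk⟩ := hne
  apply le_antisymm
  · intro v hv
    rw [LinearMap.mem_ker] at hv
    have hb : ∀ i ∈ I, v.2 i = 0 := fun i hi => snd_apply_eq_zero_of_psi_eI hk hv hi
    have ha : ∀ i ∉ I, v.1 i = 0 := fun i hi => fst_apply_eq_zero_of_psi_eI hI hb hv hi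
    have hsum : v.1 = ∑ i : I, v.1 i • (Pi.single i.1 1 : Evec N) := by
      rw [Finset.sum_coe_sort I fun i => v.1 i • (Pi.single i 1 : Evec N)]
      rw [Finset.sum_subset (Finset.subset_univ I)
        fun i _ hi => by rw [ha i hi, zero_smul]]
      funext j
      simp [Finset.sum_apply, Pi.single_apply]
    have hη : ExteriorAlgebra.ι ℂ v.1 * eI I = 0 := by
      rw [hsum, map_sum, Finset.sum_mul]
      exact Finset.sum_eq_zero fun i _ => by
        rw [map_smul, smul_mul_assoc, ι_single_mul_eI i.2, smul_zero]
    rw [psi_eI_of_snd hb, hη, zero_add] at hv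
    have h2 := snd_eq_zero_of_contractLeft_eI_univ hv
    have hv' : v = ∑ i : I, v.1 i • ((Pi.single i.1 1, 0) : Vsp N) := by
      refine Prod.ext ?_ ?_
      · rw [Prod.fst_sum]; exact hsum
      · rw [Prod.snd_sum, h2]; simp
    rw [hv']
    exact Submodule.sum_mem _ fun i _ =>
      Submodule.smul_mem _ _ (Submodule.subset_span ⟨i, rfl⟩)
  · rw [Submodule.span_le]
    rintro _ ⟨i, rfl⟩
    exact psi_eI_single i.2

/-- Vectors of `V` whose `E`-components are distinct basis vectors are independent. -/
theorem linearIndependent_of_fst_single {N : ℕ} {κ : Type*} {g : κ → Fin N}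
    (hg : Function.Injective g) (c : κ → Evec N) :
    LinearIndependent ℂ fun i => ((Pi.single (g i) 1, c i) : Vsp N) := by
  apply LinearIndependent.of_comp (LinearMap.fst ℂ (Evec N) (Evec N))
  have h := (Pi.basisFun ℂ (Fin N)).linearIndependent.comp g hg
  convert h using 1
  funext i
  simp


theorem eI_univ_eq_of_top_pair {N : ℕ} {I : Finset (Fin N)} {p q : Fin N} (hpq : p < q)
    (hI : ∀ i ∈ I, i < p) (hcov : ∀ i, i ∈ I ∨ i = p ∨ i = q) :
    eI Finset.univ = ExteriorAlgebra.ι ℂ (Pi.single p 1) *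
      (ExteriorAlgebra.ι ℂ (Pi.single q 1) * eI I) := by
  have hnodup : (I.sort (· ≤ ·) ++ [p, q]).Nodup := by
    refine List.Nodup.append (I.sort_nodup _) (by simp [hpq.ne]) ?_
    intro i hi hi'
    have h1 := hI i (by simpa using hi)
    simp only [List.mem_cons, List.not_mem_nil, or_false] at hi'
    rcases hi' with rfl | rfl
    · exact h1.false
    · exact (h1.trans hpq).false
  have hsorted : (I.sort (· ≤ ·) ++ [p, q]).Pairwise (· ≤ ·) := by
    refine List.pairwise_append.2 ⟨I.pairwise_sort _, by simp [hpq.le], ?_⟩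
    intro i hi j hj
    have h1 := hI i (by simpa using hi)
    simp only [List.mem_cons, List.not_mem_nil, or_false] at hj
    rcases hj with rfl | rfl
    · exact h1.le
    · exact (h1.trans hpq).le
  have huniv : (Finset.univ : Finset (Fin N)) = (I.sort (· ≤ ·) ++ [p, q]).toFinset := by
    ext i
    have := hcov i
    simp
    tauto
  rw [eI_eq_wedgeList I, ← wedgeList_append_pair, huniv, eI_eq_wedgeList,
    (List.toFinset_sort (· ≤ ·) hnodup).2 hsorted]

/-- If `I` omits exactly the two top indices `p < q`, then the annihilator of `e_{[N]} + e_I`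
is spanned by `e_i` for `i ∈ I`, `e_p + f_q` and `e_q - f_p`. -/
theorem ker_psi_eI_univ_add_of_top_pair {N : ℕ} {I : Finset (Fin N)} {p q : Fin N}
    (hpq : p < q) (hI : ∀ i ∈ I, i < p) (hcov : ∀ i, i ∈ I ∨ i = p ∨ i = q) :
    LinearMap.ker (psi (eI Finset.univ + eI I)) =
      Submodule.span ℂ (Set.range fun i : Fin N => ((Pi.single i 1,
        if i = p then Pi.single q 1 else if i = q then -Pi.single p 1 else 0) : Vsp N)) := by
  have hp : p ∉ I := fun h => (hI p h).false
  have hq : q ∉ I := fun h => ((hI q h).trans hpq).false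
  have hω := eI_univ_eq_of_top_pair hpq hI hcov
  have hpker : psi (eI Finset.univ + eI I) (Pi.single p 1, Pi.single q 1) = 0 := by
    rw [psi_eI_of_snd]
    · simp only [hω]
      rw [contractLeft_ι_mul_exterior, contractLeft_single_ι_mul_eI hq]
      simp [toDualMap_single, hpq.ne']
    · rintro i hi
      exact Pi.single_eq_of_ne (by rintro rfl; exact hq hi) _
  have hqker : psi (eI Finset.univ + eI I) (Pi.single q 1, -Pi.single p 1) = 0 := by
    rw [psi_eI_of_snd]
    · simp only [hω]
      rw [map_neg, map_neg, LinearMap.neg_apply, contractLeft_ι_mul_exterior,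
        contractLeft_single_ι_mul_eI hp]
      simp [toDualMap_single, hpq.ne]
    · rintro i hi
      have hip : i ≠ p := by rintro rfl; exact hp hi
      simp [hip]
  apply le_antisymm
  · intro v hv
    rw [LinearMap.mem_ker] at hv
    have hx := eI_univ_add_eI_ne_zero hp
    have hb : ∀ i ∈ I, v.2 i = 0 := fun i hi => snd_apply_eq_zero_of_psi_eI hp hv hi
    have h1 : v.1 q + v.2 p = 0 := by
      simpa [toDualMap_single_left, toDualMap_single_right] using
        isotropic_of_mem_ker_psi hx hv hpker
    have h2 : -v.1 p + v.2 q = 0 := by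
      simpa [toDualMap_single_left, toDualMap_single_right] using
        isotropic_of_mem_ker_psi hx hv hqker
    have hv' : v = ∑ i : Fin N, v.1 i • ((Pi.single i 1,
        if i = p then Pi.single q 1 else if i = q then -Pi.single p 1 else 0) : Vsp N) := by
      refine Prod.ext ?_ ?_
      · rw [Prod.fst_sum]
        funext j
        simp [Finset.sum_apply, Pi.single_apply]
      · rw [Prod.snd_sum, Finset.sum_eq_add p q hpq.ne
          (fun i _ hi => by simp [hi.1, hi.2]) (by simp) (by simp)]
        funext j
        rcases hcov j with hj | rfl | rfl
        · have hjp : j ≠ p := by rintro rfl; exact hp hj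
          have hjq : j ≠ q := by rintro rfl; exact hq hj
          simp [hb j hj, hpq.ne', hjp, hjq]
        · simp only [hpq.ne, hpq.ne', Prod.smul_mk, if_true, if_false, Pi.add_apply,
            Pi.smul_apply, Pi.neg_apply, Pi.single_eq_same, Pi.single_eq_of_ne hpq.ne,
            smul_eq_mul]
          linear_combination h1
        · simp only [hpq.ne, hpq.ne', Prod.smul_mk, if_true, if_false, Pi.add_apply,
            Pi.smul_apply, Pi.neg_apply, Pi.single_eq_same, Pi.single_eq_of_ne hpq.ne',
            smul_eq_mul]
          linear_combination h2
    rw [hv']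
    exact Submodule.sum_mem _ fun i _ =>
      Submodule.smul_mem _ _ (Submodule.subset_span ⟨i, rfl⟩)
  · rw [Submodule.span_le]
    rintro _ ⟨i, rfl⟩
    rcases hcov i with hi | rfl | rfl
    · have hip : i ≠ p := by rintro rfl; exact hp hi
      have hiq : i ≠ q := by rintro rfl; exact hq hi
      simpa [hip, hiq] using psi_eI_single hi
    · simpa using hpker
    · simpa [hpq.ne'] using hqker

theorem finrank_span_range_of_fst_single {N : ℕ} {κ : Type*} [Fintype κ] {g : κ → Fin N}
    (hg : Function.Injective g) (c : κ → Evec N) :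
    Module.finrank ℂ (Submodule.span ℂ
      (Set.range fun i => ((Pi.single (g i) 1, c i) : Vsp N))) = Fintype.card κ :=
  finrank_span_eq_card (linearIndependent_of_fst_single hg c)

theorem range_single_filter_val_lt {N M : ℕ} :
    (Set.range fun i : (Finset.univ.filter fun k : Fin N => k.1 < M) =>
      ((Pi.single i.1 1, 0) : Vsp N)) =
      {v : Vsp N | ∃ i : Fin N, i.1 < M ∧ v = (Pi.single i 1, 0)} := by
  ext v
  simp [eq_comm]

theorem finrank_span_single_val_lt {N M : ℕ} (hM : M ≤ N) :
    Module.finrank ℂ (Submodule.span ℂ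
      {v : Vsp N | ∃ i : Fin N, i.1 < M ∧ v = (Pi.single i 1, 0)}) = M := by
  rw [← range_single_filter_val_lt,
    finrank_span_range_of_fst_single Subtype.val_injective fun _ => 0]
  rw [Fintype.card_coe, Fin.card_filter_val_lt, min_eq_right hM]

/-- For `N` even and `2 ≤ l ≤ N/2`, the kernel of Clifford
multiplication `v ↦ v ⋅ (e_{[N]} + e_{[N-2l]})` equals `span(e_1, …, e_{N-2l})`,
of dimension `N - 2l`; for `l = 1` it strictly contains `span(e_1, …, e_{N-2})` and
equals `span(e_1, …, e_{N-2}, e_{N-1} + f_N, e_N - f_{N-1})`, of dimension `N`. -/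
theorem stmt3 (N : ℕ) (hN : Even N) (h2 : 2 ≤ N) :
    (∀ l : ℕ, 2 ≤ l → 2 * l ≤ N →
      LinearMap.ker (psi (eI (Finset.univ : Finset (Fin N)) +
          eI (Finset.univ.filter fun k : Fin N => k.1 < N - 2 * l))) =
        Submodule.span ℂ
          {v : Vsp N | ∃ i : Fin N, i.1 < N - 2 * l ∧ v = (Pi.single i 1, 0)} ∧
      Module.finrank ℂ
        (LinearMap.ker (psi (eI (Finset.univ : Finset (Fin N)) +
          eI (Finset.univ.filter fun k : Fin N => k.1 < N - 2 * l)))) = N - 2 * l) ∧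
    (Submodule.span ℂ
        {v : Vsp N | ∃ i : Fin N, i.1 < N - 2 ∧ v = (Pi.single i 1, 0)} <
      LinearMap.ker (psi (eI (Finset.univ : Finset (Fin N)) +
        eI (Finset.univ.filter fun k : Fin N => k.1 < N - 2))) ∧
      LinearMap.ker (psi (eI (Finset.univ : Finset (Fin N)) +
          eI (Finset.univ.filter fun k : Fin N => k.1 < N - 2))) =
        Submodule.span ℂ
          ({v : Vsp N | ∃ i : Fin N, i.1 < N - 2 ∧ v = (Pi.single i 1, 0)} ∪
           {(Pi.single (⟨N - 2, by omega⟩ : Fin N) 1,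
             Pi.single (⟨N - 1, by omega⟩ : Fin N) 1),
            (Pi.single (⟨N - 1, by omega⟩ : Fin N) 1,
             -Pi.single (⟨N - 2, by omega⟩ : Fin N) 1)}) ∧
      Module.finrank ℂ
        (LinearMap.ker (psi (eI (Finset.univ : Finset (Fin N)) +
          eI (Finset.univ.filter fun k : Fin N => k.1 < N - 2)))) = N) := by
  refine ⟨fun l hl hlN => ?_, ?_⟩
  · have hker : LinearMap.ker (psi (eI (Finset.univ : Finset (Fin N)) +
          eI (Finset.univ.filter fun k : Fin N => k.1 < N - 2 * l))) =
        Submodule.span ℂ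
          {v : Vsp N | ∃ i : Fin N, i.1 < N - 2 * l ∧ v = (Pi.single i 1, 0)} := by
      rw [ker_psi_eI_univ_add, range_single_filter_val_lt]
      · exact ⟨⟨N - 1, by omega⟩, by simp; omega⟩
      · intro i _
        have hex : ∀ m n : ℕ, ∃ j : Fin N, N - 2 * l ≤ j.1 ∧ j.1 ≠ m ∧ j.1 ≠ n := by
          intro m n
          by_cases h1 : N - 1 ≠ m ∧ N - 1 ≠ n
          · exact ⟨⟨N - 1, by omega⟩, by simp only; omega⟩
          · by_cases h2 : N - 2 ≠ m ∧ N - 2 ≠ n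
            · exact ⟨⟨N - 2, by omega⟩, by simp only; omega⟩
            · exact ⟨⟨N - 3, by omega⟩, by simp only; omega⟩
        obtain ⟨j, hj, hji, -⟩ := hex i i
        obtain ⟨k, hk, hki, hkj⟩ := hex i j
        exact ⟨j, by simpa using hj, k, by simpa using hk, Fin.val_ne_iff.1 hji,
          Fin.val_ne_iff.1 hki, Fin.val_ne_iff.1 hkj⟩
    exact ⟨hker, by rw [hker, finrank_span_single_val_lt (Nat.sub_le _ _)]⟩
  · have hpq : (⟨N - 2, by omega⟩ : Fin N) < ⟨N - 1, by omega⟩ := by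
      rw [Fin.mk_lt_mk]; omega
    have hker := ker_psi_eI_univ_add_of_top_pair
      (I := Finset.univ.filter fun k : Fin N => k.1 < N - 2) hpq
      (fun i hi => by simpa [Fin.lt_def] using hi)
      (fun i => by simp only [Finset.mem_filter, Finset.mem_univ, true_and, Fin.ext_iff]; omega)
    have hrank : Module.finrank ℂ
        (LinearMap.ker (psi (eI (Finset.univ : Finset (Fin N)) +
          eI (Finset.univ.filter fun k : Fin N => k.1 < N - 2)))) = N := by
      rw [hker, finrank_span_range_of_fst_single (g := fun i : Fin N => i) fun _ _ h => h]
      simp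
    refine ⟨lt_of_le_of_ne ?_ fun h => ?_, ?_, hrank⟩
    · rw [Submodule.span_le]
      rintro _ ⟨i, hi, rfl⟩
      exact psi_eI_single (by simpa using hi)
    · rw [← h, finrank_span_single_val_lt (Nat.sub_le _ _)] at hrank
      omega
    · rw [hker]
      congr 1
      ext v
      constructor
      · rintro ⟨i, rfl⟩
        by_cases hp : i = ⟨N - 2, by omega⟩
        · exact Or.inr (Or.inl (by simp [hp]))
        · by_cases hq : i = ⟨N - 1, by omega⟩
          · exact Or.inr (Or.inr (by simp [hq, hpq.ne']))
          · refine Or.inl ⟨i, ?_, by simp only [if_neg hp, if_neg hq]⟩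
            rw [Fin.ext_iff] at hp hq
            simp only at hp hq
            omega
      · rintro (⟨i, hi, rfl⟩ | rfl | rfl)
        · refine ⟨i, ?_⟩
          have hp : i ≠ ⟨N - 2, by omega⟩ := by rw [Ne, Fin.ext_iff]; simp only; omega
          have hq : i ≠ ⟨N - 1, by omega⟩ := by rw [Ne, Fin.ext_iff]; simp only; omega
          simp only [if_neg hp, if_neg hq]
        · exact ⟨⟨N - 2, by omega⟩, by simp⟩
        · exact ⟨⟨N - 1, by omega⟩, by simp only [if_neg hpq.ne', if_true]⟩
end
end

section
/- For N even, N ≥ 6, and 3 ≤ l ≤ N/2, every point of the secant orbit Σ_{l,N} is identifiable: if [e_{[N]} + e_{[N−2l]}] = [a + b] with [a],[b] ∈ S_N^+, then {[a],[b]} = {[e_{[N]}], [e_{[N−2l]}]}. The proof reduces, via H_a ∩ H_b = span(e_1,…,e_{N−2l}) and factorization a = e_{[N−2l]}∧a', b = e_{[N−2l]}∧b', to the identifiability of the general point of σ_2(S_{2l}^+). -/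
/- Formalization of a statement about spinor varieties (Galgano, arXiv:2302.05295). -/

noncomputable section
open CliffordAlgebra

/-- The even part `⋀^{ev} E` of the exterior algebra (one half-spin representation). -/
def evenPart (N : ℕ) : Submodule ℂ (ExtE N) :=
  CliffordAlgebra.evenOdd (0 : QuadraticForm ℂ (Evec N)) 0

/-- The odd part `⋀^{od} E` of the exterior algebra (the other half-spin representation). -/
def oddPart (N : ℕ) : Submodule ℂ (ExtE N) :=
  CliffordAlgebra.evenOdd (0 : QuadraticForm ℂ (Evec N)) 1

/-- A (representative of a) pure spinor of the even half-spin representation: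
a nonzero even spinor whose isotropic annihilator `H_a = ker ψ_a` is maximal,
of dimension `N`. -/
def purespinor {N : ℕ} (a : ExtE N) : Prop :=
  a ≠ 0 ∧ a ∈ evenPart N ∧ Module.finrank ℂ (LinearMap.ker (psi a)) = N

/-- The spinor variety `S_N^+`, as a set of points of the projective space
`ℙ(⋀^{ev}E) ⊆ ℙ(⋀E)`. -/
def SpinorVariety (N : ℕ) : Set (Projectivization ℂ (ExtE N)) :=
  {p | ∃ (a : ExtE N) (h : a ≠ 0), purespinor a ∧ p = Projectivization.mk ℂ a h}

/-- The projective line through `p` and `q` is contained in `X`. -/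
def lineIn {K V : Type*} [DivisionRing K] [AddCommGroup V] [Module K V]
    (X : Set (Projectivization K V)) (p q : Projectivization K V) : Prop :=
  ∀ r : Projectivization K V, r.submodule ≤ p.submodule ⊔ q.submodule → r ∈ X

/-- There is a chain of `r` lines inside `X` connecting `p` to `q`. -/
def chainDist {K V : Type*} [DivisionRing K] [AddCommGroup V] [Module K V]
    (X : Set (Projectivization K V)) (p q : Projectivization K V) (r : ℕ) : Prop :=
  ∃ c : ℕ → Projectivization K V, c 0 = p ∧ c r = q ∧ (∀ i ≤ r, c i ∈ X) ∧
    ∀ i < r, lineIn X (c i) (c (i + 1))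

/-- The Hamming distance on `X`: the minimal number of lines inside `X` needed to
connect `p` to `q`. -/
def hdist {K V : Type*} [DivisionRing K] [AddCommGroup V] [Module K V]
    (X : Set (Projectivization K V)) (p q : Projectivization K V) : ℕ :=
  sInf {r | chainDist X p q r}

section SpinModule

open Module LinearMap

theorem exists_biorthogonal {ι W : Type*} [Fintype ι] [DecidableEq ι] [AddCommGroup W]
    [Module ℂ W] {φ : ι → Dual ℂ W} (h : LinearIndependent ℂ φ) :
    ∃ f : ι → W, ∀ i j, φ i (f j) = if i = j then 1 else 0 := by
  have hφ : LinearIndependent ℂ (fun i w => φ i w : ι → W → ℂ) :=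
    h.map' (ltoFun ℂ W ℂ ℂ) (ker_eq_bot.2 DFunLike.coe_injective)
  have hsurj : range (LinearMap.pi φ) = ⊤ := by
    rw [eq_top_iff, ← span_flip_eq_top_iff_linearIndependent.2 hφ, Submodule.span_le]
    rintro _ ⟨w, rfl⟩
    exact ⟨w, rfl⟩
  choose f hf using fun j => range_eq_top.1 hsurj (Pi.single j 1)
  refine ⟨f, fun i j => ?_⟩
  have := congrFun (hf j) i
  simpa [Pi.single_apply] using this

variable {V S : Type*} [AddCommGroup V] [Module ℂ V] [AddCommGroup S] [Module ℂ S]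

/-- The vectors annihilating a spinor. -/
def spinorAnnihilator (γ : V →ₗ[ℂ] S →ₗ[ℂ] S) (x : S) : Submodule ℂ V := ker (γ.flip x)

/-- A spinor is pure if it is nonzero and annihilated by an `N`-dimensional space of vectors. -/
def IsPure (γ : V →ₗ[ℂ] S →ₗ[ℂ] S) (N : ℕ) (x : S) : Prop :=
  x ≠ 0 ∧ finrank ℂ (spinorAnnihilator γ x) = N

/-- `γ` is a Clifford action of the nondegenerate quadratic space `(V, B)` of dimension `2N`
on a space `S` of dimension `2 ^ N`. -/
structure IsSpinModule (B : LinearMap.BilinForm ℂ V) (γ : V →ₗ[ℂ] S →ₗ[ℂ] S) (N : ℕ) : Prop where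
  anticomm : ∀ v w x, γ v (γ w x) + γ w (γ v x) = B v w • x
  symm : ∀ v w, B v w = B w v
  nondegenerate : B.Nondegenerate
  finrank_vectors : finrank ℂ V = 2 * N
  finrank_spinors : finrank ℂ S = 2 ^ N

variable {B : LinearMap.BilinForm ℂ V} {γ : V →ₗ[ℂ] S →ₗ[ℂ] S} {N : ℕ}

@[simp]
theorem mem_spinorAnnihilator {x : S} {v : V} : v ∈ spinorAnnihilator γ x ↔ γ v x = 0 :=
  Iff.rfl

namespace IsSpinModule

theorem swap (h : IsSpinModule B γ N) (v w : V) (x : S) :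
    γ v (γ w x) = B v w • x - γ w (γ v x) := by
  rw [← h.anticomm v w x]; abel

theorem isRefl (h : IsSpinModule B γ N) : B.IsRefl := fun v w hvw => by
  rw [h.symm]; exact hvw

theorem isotropic (h : IsSpinModule B γ N) {x : S} (hx : x ≠ 0) {v w : V}
    (hv : γ v x = 0) (hw : γ w x = 0) : B v w = 0 := by
  have := h.anticomm v w x
  rw [hv, hw, map_zero, map_zero, add_zero] at this
  exact (smul_eq_zero.1 this.symm).resolve_right hx

theorem le_orthogonal_annihilator (h : IsSpinModule B γ N) {x : S} (hx : x ≠ 0) :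
    spinorAnnihilator γ x ≤ B.orthogonal (spinorAnnihilator γ x) := fun _ hv _ hw =>
  h.isotropic hx (mem_spinorAnnihilator.1 hw) (mem_spinorAnnihilator.1 hv)

/-- The common kernel of `n` anticommuting annihilation operators admitting dual creation
operators has codimension factor `2 ^ n`. -/
theorem finrank_iInf_ker [FiniteDimensional ℂ S] (h : IsSpinModule B γ N) :
    ∀ (n : ℕ) (e f : Fin n → V),
    (∀ i j, B (e i) (e j) = 0) → (∀ i j, B (e i) (f j) = if i = j then 1 else 0) →
    finrank ℂ S = 2 ^ n * finrank ℂ (⨅ i, ker (γ (e i)) : Submodule ℂ S)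
  | 0, _, _, _, _ => by rw [iInf_of_empty, finrank_top, pow_zero, one_mul]
  | n + 1, e, f, hee, hef => by
    have ih := h.finrank_iInf_ker n (fun i => e i.castSucc) (fun i => f i.castSucc)
      (fun i j => hee _ _) (fun i j => by rw [hef]; simp)
    set K : Submodule ℂ S := ⨅ i : Fin n, ker (γ (e i.castSucc)) with hK
    set u := e (Fin.last n) with hu
    set w := f (Fin.last n) with hw
    have memK : ∀ x, x ∈ K ↔ ∀ i : Fin n, γ (e i.castSucc) x = 0 := by simp [hK]
    have huu : ∀ x, γ u (γ u x) = 0 := fun x => by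
      have := h.anticomm u u x
      rw [hee, zero_smul, ← two_smul ℂ] at this
      exact (smul_eq_zero.1 this).resolve_left two_ne_zero
    have hsplit : (⨅ i, ker (γ (e i)) : Submodule ℂ S) = K ⊓ ker (γ u) := by
      ext x
      simp [memK, Fin.forall_fin_succ', hu]
    have hker : (ker (γ u ∘ₗ K.subtype)).map K.subtype = K ⊓ ker (γ u) := by
      rw [ker_comp, Submodule.map_comap_subtype]
    have hrange : range (γ u ∘ₗ K.subtype) = K ⊓ ker (γ u) := by
      ext y
      constructor
      · rintro ⟨x, rfl⟩
        refine ⟨(memK _).2 fun i => ?_, by simpa using huu _⟩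
        have := (memK _).1 x.2 i
        have hsw := h.swap (e i.castSucc) u x
        rw [this, map_zero, hu, hee, zero_smul, sub_zero] at hsw
        exact hsw
      · rintro ⟨hy, hyu : γ u y = 0⟩
        refine ⟨⟨γ w y, (memK _).2 fun i => ?_⟩, ?_⟩
        · have hne : i.castSucc ≠ Fin.last n := (Fin.castSucc_lt_last i).ne
          rw [h.swap, (memK _).1 hy i, hw, hef, if_neg hne]
          simp
        · have : B u w = 1 := by rw [hu, hw, hef, if_pos rfl]
          simp [h.swap u w, hyu, this]
    have hsum := finrank_range_add_finrank_ker (γ u ∘ₗ K.subtype)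
    rw [← Submodule.finrank_map_subtype_eq K, hker, hrange, ← hsplit] at hsum
    rw [ih, ← hsum]
    ring

variable [FiniteDimensional ℂ V]

theorem finrank_annihilator_le (h : IsSpinModule B γ N) {x : S} (hx : x ≠ 0) :
    finrank ℂ (spinorAnnihilator γ x) ≤ N := by
  have := Submodule.finrank_mono (h.le_orthogonal_annihilator hx)
  rw [LinearMap.BilinForm.finrank_orthogonal h.nondegenerate, h.finrank_vectors] at this
  lia

theorem orthogonal_annihilator (h : IsSpinModule B γ N) {x : S} (hx : IsPure γ N x) :
    B.orthogonal (spinorAnnihilator γ x) = spinorAnnihilator γ x := by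
  refine (Submodule.eq_of_le_of_finrank_le (h.le_orthogonal_annihilator hx.1) ?_).symm
  rw [LinearMap.BilinForm.finrank_orthogonal h.nondegenerate, h.finrank_vectors, hx.2]
  lia

theorem mem_annihilator_of_orthogonal (h : IsSpinModule B γ N) {x : S} (hx : IsPure γ N x)
    {v : V} (hv : ∀ w, γ w x = 0 → B w v = 0) : γ v x = 0 := by
  rw [← mem_spinorAnnihilator, ← h.orthogonal_annihilator hx]
  exact fun w hw => hv w (mem_spinorAnnihilator.1 hw)

/-- A vector is orthogonal to the common annihilator of two pure spinors if and only if it is a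
sum of annihilating vectors. -/
theorem exists_add_of_orthogonal (h : IsSpinModule B γ N) {a b : S} (ha : IsPure γ N a)
    (hb : IsPure γ N b) {v : V} (hv : ∀ u, γ u a = 0 → γ u b = 0 → B u v = 0) :
    ∃ p q, γ p a = 0 ∧ γ q b = 0 ∧ p + q = v := by
  have hmem : v ∈ B.orthogonal (B.orthogonal (spinorAnnihilator γ a ⊔ spinorAnnihilator γ b)) := by
    intro u hu
    refine hv u (h.mem_annihilator_of_orthogonal ha fun w hw => ?_)
      (h.mem_annihilator_of_orthogonal hb fun w hw => ?_)
    · exact hu w (Submodule.mem_sup_left (mem_spinorAnnihilator.2 hw))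
    · exact hu w (Submodule.mem_sup_right (mem_spinorAnnihilator.2 hw))
  rw [LinearMap.BilinForm.orthogonal_orthogonal h.nondegenerate h.isRefl] at hmem
  obtain ⟨p, hp, q, hq, rfl⟩ := Submodule.mem_sup.1 hmem
  exact ⟨p, q, mem_spinorAnnihilator.1 hp, mem_spinorAnnihilator.1 hq, rfl⟩

variable [FiniteDimensional ℂ S]

/-- Spinors annihilated by the same maximal isotropic subspace are proportional. -/
theorem exists_smul_eq (h : IsSpinModule B γ N) {x y : S} (hx : IsPure γ N x)
    (hy : ∀ v, γ v x = 0 → γ v y = 0) : ∃ t : ℂ, y = t • x := by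
  let b := finBasisOfFinrankEq ℂ (spinorAnnihilator γ x) hx.2
  have hli : LinearIndependent ℂ (fun i => B (b i : V)) := by
    refine (b.linearIndependent.map' _ (Submodule.ker_subtype _)).map' B ?_
    exact h.nondegenerate.ker_eq_bot
  obtain ⟨f, hf⟩ := exists_biorthogonal hli
  have key := h.finrank_iInf_ker N (fun i => (b i : V)) f
    (fun i j => h.isotropic hx.1 (mem_spinorAnnihilator.1 (b i).2)
      (mem_spinorAnnihilator.1 (b j).2)) hf
  rw [h.finrank_spinors] at key
  have hone : finrank ℂ (⨅ i, ker (γ (b i : V)) : Submodule ℂ S) = 1 := by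
    have : 0 < 2 ^ N := by positivity
    nlinarith
  have memK : ∀ z, (∀ v, γ v x = 0 → γ v z = 0) →
      z ∈ (⨅ i, ker (γ (b i : V)) : Submodule ℂ S) := fun z hz => by
    simp only [Submodule.mem_iInf, mem_ker]
    exact fun i => hz _ (mem_spinorAnnihilator.1 (b i).2)
  obtain ⟨t, ht⟩ := (finrank_eq_one_iff_of_nonzero' (⟨x, memK x fun _ => id⟩ :
    (⨅ i, ker (γ (b i : V)) : Submodule ℂ S)) (by simpa using hx.1)).1 hone ⟨y, memK y hy⟩
  exact ⟨t, congrArg Subtype.val ht.symm⟩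

end IsSpinModule

/-- Biorthogonal families completing the common annihilator of two spinors `a` and `b` to the
annihilators of `a` and of `b`. -/
structure IsFrame (B : LinearMap.BilinForm ℂ V) (γ : V →ₗ[ℂ] S →ₗ[ℂ] S) (a b : S) {k : ℕ}
    (e f : Fin k → V) : Prop where
  left : ∀ i, γ (e i) a = 0
  right : ∀ i, γ (f i) b = 0
  pairing : ∀ i j, B (e i) (f j) = if i = j then 1 else 0
  left_compl : ∀ v, γ v a = 0 → γ (v - ∑ i, B v (f i) • e i) b = 0
  right_compl : ∀ v, γ v b = 0 → γ (v - ∑ i, B (e i) v • f i) a = 0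

/-- The operator counting the occupied modes of a frame. -/
def numberOp (γ : V →ₗ[ℂ] S →ₗ[ℂ] S) {k : ℕ} (e f : Fin k → V) : S →ₗ[ℂ] S :=
  ∑ i, γ (f i) ∘ₗ γ (e i)

theorem numberOp_apply {k : ℕ} (e f : Fin k → V) (x : S) :
    numberOp γ e f x = ∑ i, γ (f i) (γ (e i) x) := by
  simp [numberOp]

namespace IsSpinModule

theorem exists_isFrame [FiniteDimensional ℂ V] (h : IsSpinModule B γ N) {a b : S}
    (ha : IsPure γ N a) (hb : IsPure γ N b) :
    ∃ (k : ℕ) (e f : Fin k → V), IsFrame B γ a b e f ∧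
      k + finrank ℂ (spinorAnnihilator γ a ⊓ spinorAnnihilator γ b : Submodule ℂ V) = N := by
  let p := B.domRestrict₁₂ (spinorAnnihilator γ a) (spinorAnnihilator γ b)
  have hp : ∀ v w, p v w = B v w := fun _ _ => rfl
  let φ := finBasis ℂ (range p)
  choose e he using fun i => (φ i).2
  obtain ⟨f, hf⟩ := exists_biorthogonal (φ.linearIndependent.map' _ (Submodule.ker_subtype _))
  have hpair : ∀ i j, B (e i) (f j) = if i = j then 1 else 0 := fun i j => by
    rw [← hp, he]; exact hf i j
  have hleft : ∀ v, γ v a = 0 → γ (v - ∑ i, B v (f i) • (e i : V)) b = 0 := fun v hv => by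
    let v' : spinorAnnihilator γ a := ⟨v, hv⟩
    have hrepr : p v' = ∑ i, φ.repr ⟨p v', mem_range_self _ _⟩ i • p (e i) := by
      have := congrArg Subtype.val (φ.sum_repr ⟨p v', mem_range_self _ _⟩)
      simp only [Submodule.coe_sum, Submodule.coe_smul] at this
      simp only [he]
      exact this.symm
    have hcoef : ∀ j, B v (f j) = φ.repr ⟨p v', mem_range_self _ _⟩ j := fun j => by
      have := LinearMap.congr_fun hrepr (f j)
      simp only [LinearMap.sum_apply, LinearMap.smul_apply, hp, hpair, smul_eq_mul, mul_ite,
        mul_one, mul_zero, Finset.sum_ite_eq', Finset.mem_univ, if_true] at this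
      exact this
    refine h.mem_annihilator_of_orthogonal hb fun w hw => ?_
    have := LinearMap.congr_fun hrepr ⟨w, hw⟩
    simp only [LinearMap.sum_apply, LinearMap.smul_apply, hp, ← hcoef] at this
    rw [h.symm]
    simp only [map_sub, map_sum, map_smul, LinearMap.sub_apply, LinearMap.sum_apply,
      LinearMap.smul_apply]
    rw [this, sub_self]
  refine ⟨_, fun i => e i, fun i => f i,
    ⟨fun i => (e i).2, fun i => (f i).2, hpair, hleft, fun v hv => ?_⟩, ?_⟩
  · refine h.mem_annihilator_of_orthogonal ha fun w hw => ?_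
    have hv' : γ (v - ∑ i, B (e i) v • (f i : V)) b = 0 := by
      have : ∀ i, γ (f i) b = 0 := fun i => (f i).2
      simp [hv, this]
    have h0 := h.isotropic hb.1 (hleft w hw) hv'
    have h1 : ∀ j, B (e j) (v - ∑ i, B (e i) v • (f i : V)) = 0 := fun j => by
      simp [hpair]
    rw [map_sub B, LinearMap.sub_apply] at h0
    rw [sub_eq_zero.1 h0]
    simp only [map_sum, map_smul, LinearMap.sum_apply, LinearMap.smul_apply, h1, smul_zero,
      Finset.sum_const_zero]
  · have hker : (ker p).map (spinorAnnihilator γ a).subtype =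
        spinorAnnihilator γ a ⊓ spinorAnnihilator γ b := by
      ext v
      simp only [Submodule.mem_map, mem_ker, Submodule.coe_subtype, Subtype.exists,
        exists_and_right, exists_eq_right, Submodule.mem_inf]
      constructor
      · rintro ⟨hv, hpv⟩
        refine ⟨hv, h.mem_annihilator_of_orthogonal hb fun w hw => ?_⟩
        rw [h.symm]
        exact LinearMap.congr_fun hpv ⟨w, hw⟩
      · rintro ⟨hv, hvb⟩
        exact ⟨hv, LinearMap.ext fun w => h.isotropic hb.1 hvb w.2⟩
    rw [← hker, Submodule.finrank_map_subtype_eq, finrank_range_add_finrank_ker, ha.2]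

theorem numberOp_gamma (h : IsSpinModule B γ N) {k : ℕ} (e f : Fin k → V) (v : V) (x : S) :
    numberOp γ e f (γ v x) = γ v (numberOp γ e f x) +
      (γ (∑ i, B (e i) v • f i) x - γ (∑ i, B (f i) v • e i) x) := by
  simp only [numberOp_apply, map_sum, map_smul, LinearMap.sum_apply, LinearMap.smul_apply,
    ← Finset.sum_sub_distrib, ← Finset.sum_add_distrib]
  refine Finset.sum_congr rfl fun i _ => ?_
  rw [h.swap (e i) v, map_sub, map_smul, h.swap (f i) v]
  abel

end IsSpinModule

namespace IsFrame

variable {a b : S} {k : ℕ} {e f : Fin k → V}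

theorem pairing' (F : IsFrame B γ a b e f) (h : IsSpinModule B γ N) (i j : Fin k) :
    B (f i) (e j) = if i = j then 1 else 0 := by
  rw [h.symm, F.pairing]; simp [eq_comm]

theorem numberOp_left (F : IsFrame B γ a b e f) : numberOp γ e f a = 0 := by
  simp [numberOp_apply, F.left]

theorem numberOp_eq_smul (F : IsFrame B γ a b e f) (h : IsSpinModule B γ N) {x : S}
    (hx : ∀ i, γ (f i) x = 0) : numberOp γ e f x = (k : ℂ) • x := by
  simp only [numberOp_apply, h.swap (f _) (e _), hx, F.pairing' h, if_true, map_zero, sub_zero,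
    one_smul, Finset.sum_const, Finset.card_univ, Fintype.card_fin, Nat.cast_smul_eq_nsmul]

theorem numberOp_right (F : IsFrame B γ a b e f) (h : IsSpinModule B γ N) :
    numberOp γ e f b = (k : ℂ) • b :=
  F.numberOp_eq_smul h F.right

theorem numberOp_gamma_left (F : IsFrame B γ a b e f) (h : IsSpinModule B γ N) (v : V) :
    numberOp γ e f (γ v a) = γ (∑ i, B (e i) v • f i) a := by
  rw [h.numberOp_gamma, F.numberOp_left]
  simp [F.left]

theorem numberOp_gamma_left_of_right (F : IsFrame B γ a b e f) (h : IsSpinModule B γ N) {v : V}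
    (hv : γ v b = 0) : numberOp γ e f (γ v a) = γ v a := by
  have := F.right_compl v hv
  rw [map_sub, LinearMap.sub_apply, sub_eq_zero] at this
  rw [F.numberOp_gamma_left h, ← this]

theorem numberOp_gamma_right (F : IsFrame B γ a b e f) (h : IsSpinModule B γ N) (v : V) :
    numberOp γ e f (γ v b) = (k : ℂ) • γ v b - γ (∑ i, B (f i) v • e i) b := by
  rw [h.numberOp_gamma, F.numberOp_right h]
  simp [F.right, sub_eq_add_neg]

theorem numberOp_gamma_right_of_left (F : IsFrame B γ a b e f) (h : IsSpinModule B γ N) {v : V}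
    (hv : γ v a = 0) : numberOp γ e f (γ v b) = (k : ℂ) • γ v b - γ v b := by
  have := F.left_compl v hv
  rw [map_sub, LinearMap.sub_apply, sub_eq_zero] at this
  rw [F.numberOp_gamma_right h]
  simp only [h.symm (f _) v]
  rw [← this]

/-- The spaces `V ⋅ a` and `V ⋅ b` meet trivially once the frame has at least three elements. -/
theorem gamma_eq_zero (F : IsFrame B γ a b e f) (h : IsSpinModule B γ N) (hk : 3 ≤ k) {v w : V}
    (hvw : γ v a = γ w b) : γ v a = 0 := by
  set n := numberOp γ e f
  set s := γ v a with hs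
  set v' := ∑ i, B (e i) v • f i
  set w' := ∑ i, B (f i) w • e i
  have hv' : γ v' b = 0 := by simp [v', F.right]
  have hw' : γ w' a = 0 := by simp [w', F.left]
  have h1 : n s = γ v' a := F.numberOp_gamma_left h v
  have h2 : n (γ v' a) = γ v' a := F.numberOp_gamma_left_of_right h hv'
  have h3 : n s = (k : ℂ) • s - γ w' b := by rw [hvw]; exact F.numberOp_gamma_right h w
  have h4 : n (γ w' b) = (k : ℂ) • γ w' b - γ w' b := F.numberOp_gamma_right_of_left h hw'
  set t := γ v' a
  have h5 : γ w' b = (k : ℂ) • s - t := by rw [← h1, h3]; abel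
  have hk1 : (k : ℂ) - 1 ≠ 0 := sub_ne_zero.2 (by exact_mod_cast (by lia : k ≠ 1))
  have hk2 : (k : ℂ) - 2 ≠ 0 := sub_ne_zero.2 (by exact_mod_cast (by lia : k ≠ 2))
  have hk0 : (k : ℂ) ≠ 0 := by exact_mod_cast (by lia : k ≠ 0)
  rw [h5, map_sub, map_smul, h1, h2] at h4
  have h6 : ((k : ℂ) - 1) • ((k : ℂ) • s - (2 : ℂ) • t) = 0 := by
    rw [← sub_eq_zero] at h4
    rw [← neg_eq_zero, ← h4]
    module
  have h7 : (k : ℂ) • s - (2 : ℂ) • t = 0 := (smul_eq_zero.1 h6).resolve_left hk1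
  have h8 : ((k : ℂ) - 2) • t = 0 := by
    have := congrArg n h7
    rw [map_sub, map_smul, map_smul, h1, h2, map_zero] at this
    rw [← this]
    module
  have h9 : t = 0 := (smul_eq_zero.1 h8).resolve_left hk2
  rw [h9, smul_zero, sub_zero] at h7
  exact (smul_eq_zero.1 h7).resolve_left hk0

end IsFrame

namespace IsSpinModule

variable {a b c d : S}

/-- The span of `Hb ⋅ a` and `Ha ⋅ b`, where `Ha` and `Hb` are the annihilators of `a`, `b`. -/
def mixedSpan (γ : V →ₗ[ℂ] S →ₗ[ℂ] S) (a b : S) : Submodule ℂ S :=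
  (spinorAnnihilator γ b).map (γ.flip a) ⊔ (spinorAnnihilator γ a).map (γ.flip b)

theorem mem_mixedSpan {x : S} :
    x ∈ mixedSpan γ a b ↔ ∃ p q, γ p b = 0 ∧ γ q a = 0 ∧ γ p a + γ q b = x := by
  simp only [mixedSpan, Submodule.mem_sup, Submodule.mem_map]
  constructor
  · rintro ⟨_, ⟨p, hp, rfl⟩, _, ⟨q, hq, rfl⟩, rfl⟩
    exact ⟨p, q, hp, hq, rfl⟩
  · rintro ⟨p, q, hp, hq, rfl⟩
    exact ⟨_, ⟨p, hp, rfl⟩, _, ⟨q, hq, rfl⟩, rfl⟩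

variable [FiniteDimensional ℂ V]

/-- The sum `a + b` determines the space `mixedSpan γ a b`. -/
theorem mixedSpan_le (h : IsSpinModule B γ N) (ha : a ≠ 0) (hb : b ≠ 0) (hc : IsPure γ N c)
    (hd : IsPure γ N d) (hab : ∀ v w, γ v a = γ w b → γ v a = 0) (hsum : a + b = c + d) :
    mixedSpan γ a b ≤ mixedSpan γ c d := by
  intro x hx
  obtain ⟨p, q, hp, hq, rfl⟩ := mem_mixedSpan.1 hx
  let T : V × V →ₗ[ℂ] S := (γ.flip a).coprod (γ.flip b)
  have hT : ∀ v w, T (v, w) = γ v a + γ w b := fun _ _ => rfl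
  let ψ : Dual ℂ (V × V) := (B q).coprod (B p)
  have hψ : ∀ v w, ψ (v, w) = B q v + B p w := fun _ _ => rfl
  have hmem : ψ ∈ (ker T).dualAnnihilator := by
    rw [Submodule.mem_dualAnnihilator]
    rintro ⟨v, w⟩ (hvw : T (v, w) = 0)
    rw [hT] at hvw
    have hv : γ v a = 0 := hab v (-w) (by
      rw [map_neg, LinearMap.neg_apply]; exact eq_neg_of_add_eq_zero_left hvw)
    rw [hv, zero_add] at hvw
    rw [hψ, h.isotropic ha hq hv, h.isotropic hb hp hvw, add_zero]
  rw [← range_dualMap_eq_dualAnnihilator_ker] at hmem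
  obtain ⟨φ, hφ⟩ := hmem
  have hφa : ∀ v, φ (γ v a) = B q v := fun v => by
    have := LinearMap.congr_fun hφ (v, 0)
    simpa [hψ, hT] using this
  have hφb : ∀ v, φ (γ v b) = B p v := fun v => by
    have := LinearMap.congr_fun hφ (0, v)
    simpa [hψ, hT] using this
  have hrep : ∀ y : S, ∃ r, ∀ v, B r v = φ (γ v y) := fun y =>
    ⟨(B.toDual h.nondegenerate).symm (φ ∘ₗ γ.flip y), fun v => by
      rw [LinearMap.BilinForm.apply_toDual_symm_apply]; rfl⟩
  obtain ⟨s, hs⟩ := hrep c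
  obtain ⟨r, hr⟩ := hrep d
  have hsc : γ s c = 0 := h.mem_annihilator_of_orthogonal hc fun w hw => by
    rw [h.symm, hs, hw, map_zero]
  have hrd : γ r d = 0 := h.mem_annihilator_of_orthogonal hd fun w hw => by
    rw [h.symm, hr, hw, map_zero]
  have hpq : p + q = r + s := by
    refine (LinearMap.ker_eq_bot.1 h.nondegenerate.ker_eq_bot) (LinearMap.ext fun v => ?_)
    rw [map_add, map_add, LinearMap.add_apply, LinearMap.add_apply, hr, hs, ← hφa, ← hφb,
      ← map_add, ← map_add, ← map_add, ← map_add, add_comm b, hsum, add_comm d]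
  refine mem_mixedSpan.2 ⟨r, s, hrd, hsc, ?_⟩
  calc γ r c + γ s d = γ (r + s) (c + d) := by simp [hsc, hrd, add_comm]
    _ = γ (p + q) (a + b) := by rw [hpq, hsum]
    _ = γ p a + γ q b := by simp [hp, hq]

theorem finrank_map_annihilator (a b : S) :
    finrank ℂ ((spinorAnnihilator γ b).map (γ.flip a)) +
      finrank ℂ (spinorAnnihilator γ b ⊓ spinorAnnihilator γ a : Submodule ℂ V) =
      finrank ℂ (spinorAnnihilator γ b) := by
  have := finrank_range_add_finrank_ker ((γ.flip a) ∘ₗ (spinorAnnihilator γ b).subtype)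
  rwa [range_comp, Submodule.range_subtype, ker_comp, ← Submodule.finrank_map_subtype_eq,
    Submodule.map_comap_subtype] at this

theorem finrank_mixedSpan_le (ha : IsPure γ N a) (hb : IsPure γ N b) :
    finrank ℂ (mixedSpan γ a b) +
      2 * finrank ℂ (spinorAnnihilator γ a ⊓ spinorAnnihilator γ b : Submodule ℂ V) ≤ 2 * N := by
  have h1 := finrank_map_annihilator (γ := γ) a b
  have h2 := finrank_map_annihilator (γ := γ) b a
  have h3 := Submodule.finrank_add_le_finrank_add_finrank
    ((spinorAnnihilator γ b).map (γ.flip a)) ((spinorAnnihilator γ a).map (γ.flip b))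
  rw [hb.2, inf_comm] at h1
  rw [ha.2] at h2
  rw [mixedSpan]
  lia

theorem finrank_mixedSpan (ha : IsPure γ N a) (hb : IsPure γ N b)
    (hab : ∀ v w, γ v a = γ w b → γ v a = 0) :
    finrank ℂ (mixedSpan γ a b) +
      2 * finrank ℂ (spinorAnnihilator γ a ⊓ spinorAnnihilator γ b : Submodule ℂ V) = 2 * N := by
  have h1 := finrank_map_annihilator (γ := γ) a b
  have h2 := finrank_map_annihilator (γ := γ) b a
  have h3 := Submodule.finrank_sup_add_finrank_inf_eq
    ((spinorAnnihilator γ b).map (γ.flip a)) ((spinorAnnihilator γ a).map (γ.flip b))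
  have h4 : (spinorAnnihilator γ b).map (γ.flip a) ⊓ (spinorAnnihilator γ a).map (γ.flip b) =
      ⊥ := by
    rw [eq_bot_iff]
    rintro _ ⟨⟨v, -, rfl⟩, ⟨w, -, hw⟩⟩
    exact hab v w hw.symm
  rw [h4, finrank_bot] at h3
  rw [hb.2, inf_comm] at h1
  rw [ha.2] at h2
  rw [mixedSpan]
  lia

theorem eq_zero_or_eq_zero_of_isPure (hcd : ∀ v w, γ v c = γ w d → γ v c = 0)
    (hU : finrank ℂ (spinorAnnihilator γ c ⊓ spinorAnnihilator γ d : Submodule ℂ V) < N)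
    {α β : ℂ} (hx : IsPure γ N (α • c + β • d)) : α = 0 ∨ β = 0 := by
  by_contra! hne
  refine hU.not_ge ?_
  rw [← hx.2]
  refine Submodule.finrank_mono fun v hv => ?_
  rw [mem_spinorAnnihilator, map_add, map_smul, map_smul] at hv
  have h1 : γ v c = γ (-(α⁻¹ * β) • v) d := by
    have := eq_neg_of_add_eq_zero_left hv
    rw [map_smul, LinearMap.smul_apply, neg_smul, mul_smul, ← smul_neg, ← this,
      inv_smul_smul₀ hne.1]
  have h2 := hcd _ _ h1
  rw [h2, smul_zero, zero_add] at hv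
  exact ⟨h2, (smul_eq_zero.1 hv).resolve_left hne.2⟩

variable [FiniteDimensional ℂ S]

/-- If every vector sends `x` into the span of two pure spinors acted on by the annihilator of the
other one, then `x` is a combination of the two, provided the frame has at least five elements. -/
theorem exists_eq_add (h : IsSpinModule B γ N) (hc : IsPure γ N c) (hd : IsPure γ N d) {k : ℕ}
    {e f : Fin k → V} (F : IsFrame B γ c d e f) (hk : 5 ≤ k) {x : S}
    (hU : ∀ u, γ u c = 0 → γ u d = 0 → γ u x = 0)
    (he : ∀ i, γ (e i) x ∈ mixedSpan γ c d) (hf : ∀ i, γ (f i) x ∈ mixedSpan γ c d) :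
    ∃ α β : ℂ, x = α • c + β • d := by
  set n := numberOp γ e f with hn
  have hk0 : (k : ℂ) ≠ 0 := by exact_mod_cast (by lia : k ≠ 0)
  have hk4 : (k : ℂ) - 4 ≠ 0 := sub_ne_zero.2 (by exact_mod_cast (by lia : k ≠ 4))
  have heig : ∀ y ∈ mixedSpan γ c d, n (n y) - (k : ℂ) • n y + ((k : ℂ) - 1) • y = 0 := by
    intro y hy
    obtain ⟨p, q, hp, hq, rfl⟩ := mem_mixedSpan.1 hy
    have h1 : n (γ p c) = γ p c := F.numberOp_gamma_left_of_right h hp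
    have h2 : n (γ q d) = (k : ℂ) • γ q d - γ q d := F.numberOp_gamma_right_of_left h hq
    simp only [map_add, map_sub, map_smul, h1, h2]
    module
  have hne : ∀ i y, n (γ (e i) y) = γ (e i) (n y) - γ (e i) y := fun i y => by
    rw [hn, h.numberOp_gamma]
    have h1 : ∀ j, B (e j) (e i) = 0 := fun j => h.isotropic hc.1 (F.left j) (F.left i)
    simp [h1, F.pairing' h, sub_eq_add_neg]
  have hnf : ∀ i y, n (γ (f i) y) = γ (f i) (n y) + γ (f i) y := fun i y => by
    rw [hn, h.numberOp_gamma]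
    have h1 : ∀ j, B (f j) (f i) = 0 := fun j => h.isotropic hd.1 (F.right j) (F.right i)
    simp [h1, F.pairing]
  have hy : ∀ i, γ (e i) (n (n x) - ((k : ℂ) + 2) • n x + (2 * (k : ℂ)) • x) = 0 := fun i => by
    rw [← heig _ (he i)]
    simp only [hne, map_add, map_sub, map_smul]
    module
  have hz : ∀ i, γ (f i) (n (n x) - ((k : ℂ) - 2) • n x) = 0 := fun i => by
    rw [← heig _ (hf i)]
    simp only [hnf, map_add, map_sub, map_smul]
    module
  have hy' : n (n (n x) - ((k : ℂ) + 2) • n x + (2 * (k : ℂ)) • x) = 0 := by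
    rw [hn, numberOp_apply]
    exact Finset.sum_eq_zero fun i _ => by rw [hy, map_zero]
  have hz' := F.numberOp_eq_smul h hz
  rw [← hn] at hz'
  have hsq : n (n x) = (k : ℂ) • n x := by
    simp only [map_add, map_sub, map_smul] at hy' hz'
    have : ((k : ℂ) - 4) • (n (n x) - (k : ℂ) • n x) = 0 := by
      rw [← sub_eq_zero] at hz'
      rw [← sub_eq_zero.2 (hy'.trans hz'.symm)]
      module
    exact sub_eq_zero.1 ((smul_eq_zero.1 this).resolve_left hk4)
  have hU' : ∀ u, γ u c = 0 → γ u d = 0 → γ u (n x) = 0 := fun u huc hud => by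
    have h1 : ∀ i, B (e i) u = 0 := fun i => h.isotropic hc.1 (F.left i) huc
    have h2 : ∀ i, B (f i) u = 0 := fun i => h.isotropic hd.1 (F.right i) hud
    have := h.numberOp_gamma e f u x
    simpa [h1, h2, hU u huc hud] using this.symm
  have hc' : ∀ v, γ v c = 0 → γ v ((k : ℂ) • x - n x) = 0 := fun v hv => by
    have hu : γ (v - ∑ i, B v (f i) • e i) c = 0 := by simp [hv, F.left]
    have h1 := hU _ hu (F.left_compl v hv)
    have h2 := hU' _ hu (F.left_compl v hv)
    have h3 : ∀ i, γ (e i) ((k : ℂ) • x - n x) = 0 := fun i => by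
      have h5 : (2 : ℂ) • γ (e i) ((k : ℂ) • x - n x) = 0 := by
        rw [← map_smul, ← hy i, hsq]
        congr 1
        module
      exact (smul_eq_zero.1 h5).resolve_left two_ne_zero
    have h4 : γ (v - ∑ i, B v (f i) • e i) ((k : ℂ) • x - n x) = 0 := by
      rw [map_sub, map_smul, h1, h2, smul_zero, sub_zero]
    simpa only [map_sub γ, map_sum, map_smul γ, LinearMap.sub_apply, LinearMap.sum_apply,
      LinearMap.smul_apply, h3, smul_zero, Finset.sum_const_zero, sub_zero] using h4
  have hd' : ∀ v, γ v d = 0 → γ v (n x) = 0 := fun v hv => by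
    have hu : γ (v - ∑ i, B (e i) v • f i) d = 0 := by simp [hv, F.right]
    have h2 := hU' _ (F.right_compl v hv) hu
    have h3 : ∀ i, γ (f i) (n x) = 0 := fun i => by
      have h5 : (2 : ℂ) • γ (f i) (n x) = 0 := by
        rw [← map_smul, ← hz i, hsq]
        congr 1
        module
      exact (smul_eq_zero.1 h5).resolve_left two_ne_zero
    simpa only [map_sub γ, map_sum, map_smul γ, LinearMap.sub_apply, LinearMap.sum_apply,
      LinearMap.smul_apply, h3, smul_zero, Finset.sum_const_zero, sub_zero] using h2
  obtain ⟨α, hα⟩ := h.exists_smul_eq hc hc'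
  obtain ⟨β, hβ⟩ := h.exists_smul_eq hd hd'
  refine ⟨(k : ℂ)⁻¹ * α, (k : ℂ)⁻¹ * β, ?_⟩
  rw [mul_smul, mul_smul, ← hα, ← hβ, ← smul_add, sub_add_cancel, smul_smul, inv_mul_cancel₀ hk0,
    one_smul]

/-- A sum of two pure spinors whose annihilators meet in codimension at least five has no other
decomposition as a sum of two pure spinors. -/
theorem identifiable (h : IsSpinModule B γ N) (ha : IsPure γ N a) (hb : IsPure γ N b)
    (hc : IsPure γ N c) (hd : IsPure γ N d)
    (hU : finrank ℂ (spinorAnnihilator γ a ⊓ spinorAnnihilator γ b : Submodule ℂ V) + 5 ≤ N)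
    (hsum : a + b = c + d) : (c = a ∧ d = b) ∨ (c = b ∧ d = a) := by
  obtain ⟨k, e, f, F, hk⟩ := h.exists_isFrame ha hb
  obtain ⟨l, e', f', F', hl⟩ := h.exists_isFrame hc hd
  have hab : ∀ v w, γ v a = γ w b → γ v a = 0 := fun v w => F.gamma_eq_zero h (by lia)
  have hle := h.mixedSpan_le ha.1 hb.1 hc hd hab hsum
  have hkl : k ≤ l := by
    have h1 := finrank_mixedSpan ha hb hab
    have h2 := finrank_mixedSpan_le hc hd
    have h3 := Submodule.finrank_mono hle
    lia
  have hcd : ∀ v w, γ v c = γ w d → γ v c = 0 := fun v w => F'.gamma_eq_zero h (by lia)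
  have hUab : ∀ u, γ u c = 0 → γ u d = 0 → γ u a = 0 ∧ γ u b = 0 := fun u hc' hd' => by
    have h1 : γ u a + γ u b = 0 := by rw [← map_add, hsum, map_add, hc', hd', add_zero]
    have h2 : γ u a = 0 := hab u (-u) (by
      rw [map_neg, LinearMap.neg_apply]; exact eq_neg_of_add_eq_zero_left h1)
    exact ⟨h2, by rwa [h2, zero_add] at h1⟩
  have hUcd : ∀ u, γ u a = 0 → γ u b = 0 → γ u c = 0 ∧ γ u d = 0 := fun u ha' hb' => by
    have h1 : γ u c + γ u d = 0 := by rw [← map_add, ← hsum, map_add, ha', hb', add_zero]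
    have h2 : γ u c = 0 := hcd u (-u) (by
      rw [map_neg, LinearMap.neg_apply]; exact eq_neg_of_add_eq_zero_left h1)
    exact ⟨h2, by rwa [h2, zero_add] at h1⟩
  have hmem : ∀ v, (∀ u, γ u c = 0 → γ u d = 0 → B u v = 0) → γ v a ∈ mixedSpan γ c d := by
    intro v hv
    obtain ⟨p, q, hp, hq, rfl⟩ := h.exists_add_of_orthogonal ha hb fun u ha' hb' =>
      hv u (hUcd u ha' hb').1 (hUcd u ha' hb').2
    refine hle (mem_mixedSpan.2 ⟨q, 0, hq, by simp, ?_⟩)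
    simp [hp]
  obtain ⟨α, β, hx⟩ := h.exists_eq_add hc hd F' (by lia) (fun u hc' hd' => (hUab u hc' hd').1)
    (fun i => hmem _ fun u hu _ => h.isotropic hc.1 hu (F'.left i))
    (fun i => hmem _ fun u _ hu => h.isotropic hd.1 hu (F'.right i))
  have hy : b = (1 - α) • c + (1 - β) • d := by
    rw [eq_sub_of_add_eq' hsum, hx]
    module
  have hlt : finrank ℂ (spinorAnnihilator γ c ⊓ spinorAnnihilator γ d : Submodule ℂ V) < N := by
    lia
  have h1 := eq_zero_or_eq_zero_of_isPure hcd hlt (hx ▸ ha)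
  have h2 := eq_zero_or_eq_zero_of_isPure hcd hlt (hy ▸ hb)
  rw [sub_eq_zero, sub_eq_zero] at h2
  rcases h1 with rfl | rfl
  · rcases h2 with h2 | rfl
    · exact absurd h2 one_ne_zero
    · right; constructor <;> simp [hx, hy]
  · rcases h2 with rfl | h2
    · left; constructor <;> simp [hx, hy]
    · exact absurd h2 one_ne_zero

end IsSpinModule

section PureLines

variable {a b : S}

namespace IsSpinModule

theorem isPure_of_injOn [FiniteDimensional ℂ V] (h : IsSpinModule B γ N) {x y : S}
    (hx : IsPure γ N x) (hy : y ≠ 0) (g : V →ₗ[ℂ] V) (hg : ∀ v, γ v x = 0 → γ (g v) y = 0)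
    (hinj : ∀ v, γ v x = 0 → g v = 0 → v = 0) : IsPure γ N y := by
  refine ⟨hy, (h.finrank_annihilator_le hy).antisymm ?_⟩
  rw [← hx.2]
  refine finrank_le_finrank_of_injective (f := g.restrict (p := spinorAnnihilator γ x)
    (q := spinorAnnihilator γ y) hg) (ker_eq_bot.1 (ker_eq_bot'.2 fun v hv => ?_))
  exact Subtype.ext (hinj v v.2 (congrArg Subtype.val hv))

theorem sq_eq_zero (h : IsSpinModule B γ N) {v : V} (hv : B v v = 0) (x : S) :
    γ v (γ v x) = 0 := by
  have := h.anticomm v v x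
  rw [hv, zero_smul, ← two_smul ℂ] at this
  exact (smul_eq_zero.1 this).resolve_left two_ne_zero

/-- Exchanging two annihilating vectors for dual ones moves a pure spinor along a line of pure
spinors. -/
theorem isPure_exchange [FiniteDimensional ℂ V] (h : IsSpinModule B γ N) (ha : IsPure γ N a)
    {e₁ e₂ f₁ f₂ : V} (he₁ : γ e₁ a = 0) (he₂ : γ e₂ a = 0) (h11 : B e₁ f₁ = 1)
    (h12 : B e₁ f₂ = 0) (h21 : B e₂ f₁ = 0) (h22 : B e₂ f₂ = 1) (hf11 : B f₁ f₁ = 0)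
    (hf12 : B f₁ f₂ = 0) (hf22 : B f₂ f₂ = 0) {α β : ℂ}
    (hne : α • a + β • γ f₁ (γ f₂ a) ≠ 0) : IsPure γ N (α • a + β • γ f₁ (γ f₂ a)) := by
  have hf21 : B f₂ f₁ = 0 := h.symm f₁ f₂ ▸ hf12
  have hmove : ∀ v, γ v a = 0 → γ v (γ f₁ (γ f₂ a)) = B v f₁ • γ f₂ a - B v f₂ • γ f₁ a := by
    intro v hv
    rw [h.swap v f₁, h.swap v f₂, hv, map_zero, sub_zero, map_smul]
  have hf₁ : γ f₁ (γ f₁ (γ f₂ a)) = 0 := h.sq_eq_zero hf11 _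
  have hf₂ : γ f₂ (γ f₁ (γ f₂ a)) = 0 := by
    rw [h.swap f₂ f₁, hf21, zero_smul, h.sq_eq_zero hf22, map_zero, sub_zero]
  by_cases hα : α = 0
  · subst hα
    let g : V →ₗ[ℂ] V := LinearMap.id + (B.flip f₁).smulRight (f₁ - e₁) +
      (B.flip f₂).smulRight (f₂ - e₂)
    have hg : ∀ v, g v = v + B v f₁ • (f₁ - e₁) + B v f₂ • (f₂ - e₂) := fun _ => rfl
    refine h.isPure_of_injOn ha hne g (fun v hv => ?_) (fun v hv hgv => ?_)
    · rw [hg]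
      simp only [zero_smul, zero_add, map_smul, map_add, map_sub, LinearMap.add_apply,
        LinearMap.sub_apply, LinearMap.smul_apply, hmove v hv, hmove e₁ he₁, hmove e₂ he₂, hf₁,
        hf₂, h11, h12, h21, h22]
      module
    · rw [hg] at hgv
      have h1 := congrArg (B e₁) hgv
      have h2 := congrArg (B e₂) hgv
      simp only [map_add, map_sub, map_smul, map_zero, h.isotropic ha.1 he₁ hv,
        h.isotropic ha.1 he₁ he₁, h.isotropic ha.1 he₁ he₂, h.isotropic ha.1 he₂ hv,
        h.isotropic ha.1 he₂ he₁, h.isotropic ha.1 he₂ he₂, h11, h12, h21, h22, smul_eq_mul,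
        sub_zero, mul_one, mul_zero, add_zero, zero_add] at h1 h2
      simpa [h1, h2] using hgv
  · let g : V →ₗ[ℂ] V := α • LinearMap.id - (B.flip f₁).smulRight (β • f₂) +
      (B.flip f₂).smulRight (β • f₁)
    have hg : ∀ v, g v = α • v - B v f₁ • β • f₂ + B v f₂ • β • f₁ := fun _ => rfl
    refine h.isPure_of_injOn ha hne g (fun v hv => ?_) (fun v hv hgv => ?_)
    · rw [hg]
      simp only [map_smul, map_add, map_sub, LinearMap.add_apply, LinearMap.sub_apply,
        LinearMap.smul_apply, hmove v hv, hf₁, hf₂, hv]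
      module
    · rw [hg] at hgv
      have h1 := congrArg (B f₁) hgv
      have h2 := congrArg (B f₂) hgv
      simp only [map_add, map_sub, map_smul, map_zero, hf11, hf12, hf21, hf22, smul_eq_mul,
        sub_zero, mul_zero, add_zero, mul_eq_zero, hα, false_or] at h1 h2
      rw [h.symm] at h1 h2
      simpa [h1, h2, hα] using hgv

end IsSpinModule

theorem IsPure.smul {t : ℂ} (ht : t ≠ 0) (ha : IsPure γ N a) : IsPure γ N (t • a) := by
  have : spinorAnnihilator γ (t • a) = spinorAnnihilator γ a := by
    ext v
    simp [ht]
  exact ⟨smul_ne_zero ht ha.1, by rw [this, ha.2]⟩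

/-- Every nonzero combination of `a` and `b` is a pure spinor. -/
def IsPureLine (γ : V →ₗ[ℂ] S →ₗ[ℂ] S) (N : ℕ) (a b : S) : Prop :=
  ∀ α β : ℂ, α • a + β • b ≠ 0 → IsPure γ N (α • a + β • b)

theorem IsPureLine.smul_right (hab : IsPureLine γ N a b) (t : ℂ) : IsPureLine γ N a (t • b) :=
  fun α β hne => by
    rw [smul_smul] at hne ⊢
    exact hab _ _ hne

theorem IsPure.isPureLine_self (ha : IsPure γ N a) : IsPureLine γ N a a := fun α β hne => by
  rw [← add_smul] at hne ⊢
  exact ha.smul (left_ne_zero_of_smul hne)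

namespace IsSpinModule

theorem exchange_ne_zero (h : IsSpinModule B γ N) (ha : IsPure γ N a) {k : ℕ} {e f : Fin k → V}
    (F : IsFrame B γ a b e f) {i j : Fin k} (hij : i ≠ j) : γ (f i) (γ (f j) a) ≠ 0 := fun h0 => by
  have h1 := h.swap (e i) (f i) (γ (f j) a)
  rw [h0, map_zero, h.swap (e i) (f j), F.left, F.pairing, F.pairing, if_neg hij] at h1
  have h2 := h.swap (e j) (f j) a
  rw [F.left, F.pairing] at h2
  simp only [if_true, one_smul, zero_smul, map_zero, sub_zero] at h1 h2
  rw [← h1, map_zero] at h2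
  exact ha.1 h2.symm

variable [FiniteDimensional ℂ V]

theorem isPureLine_exchange (h : IsSpinModule B γ N) (ha : IsPure γ N a) (hb : IsPure γ N b)
    {k : ℕ} {e f : Fin k → V} (F : IsFrame B γ a b e f) {i j : Fin k} (hij : i ≠ j) :
    IsPureLine γ N a (γ (f i) (γ (f j) a)) := fun α β hne =>
  have hf : ∀ i j, B (f i) (f j) = 0 := fun i j => h.isotropic hb.1 (F.right i) (F.right j)
  h.isPure_exchange ha (F.left i) (F.left j) (by simp [F.pairing]) (by simp [F.pairing, hij])
    (by simp [F.pairing, hij.symm]) (by simp [F.pairing]) (hf _ _) (hf _ _) (hf _ _) hne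

theorem finrank_exchange (h : IsSpinModule B γ N) (ha : IsPure γ N a) (hb : IsPure γ N b) {k : ℕ}
    {e f : Fin k → V} (F : IsFrame B γ a b e f) {i j : Fin k} (hij : i ≠ j) :
    finrank ℂ (spinorAnnihilator γ a ⊓ spinorAnnihilator γ b : Submodule ℂ V) + 2 ≤
      finrank ℂ (spinorAnnihilator γ (γ (f i) (γ (f j) a)) ⊓ spinorAnnihilator γ b :
        Submodule ℂ V) := by
  have hf : ∀ i j, B (f i) (f j) = 0 := fun i j => h.isotropic hb.1 (F.right i) (F.right j)
  set U : Submodule ℂ V := spinorAnnihilator γ a ⊓ spinorAnnihilator γ b with hU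
  set W : Submodule ℂ V := spinorAnnihilator γ (γ (f i) (γ (f j) a)) ⊓ spinorAnnihilator γ b
    with hW
  have hUW : U ≤ W := fun u hu => by
    have h1 : ∀ i, B u (f i) = 0 := fun i => h.isotropic hb.1 hu.2 (F.right i)
    refine ⟨?_, hu.2⟩
    have hua : γ u a = 0 := hu.1
    change γ u (γ (f i) (γ (f j) a)) = 0
    rw [h.swap u, h.swap u, hua]
    simp [h1]
  have hfi : f i ∈ W := ⟨h.sq_eq_zero (hf i i) _, F.right i⟩
  have hfj : f j ∈ W := by
    refine ⟨?_, F.right j⟩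
    change γ (f j) (γ (f i) (γ (f j) a)) = 0
    rw [h.swap (f j), h.sq_eq_zero (hf j j)]
    simp [hf]
  let L : W →ₗ[ℂ] ℂ × ℂ := ((B (e i)).prod (B (e j))) ∘ₗ W.subtype
  have hL : ∀ w, L w = (B (e i) w, B (e j) w) := fun _ => rfl
  have hrange : range L = ⊤ := by
    rw [range_eq_top]
    rintro ⟨s, t⟩
    refine ⟨s • ⟨f i, hfi⟩ + t • ⟨f j, hfj⟩, ?_⟩
    simp [hL, F.pairing, hij, hij.symm]
  have hker : finrank ℂ U ≤ finrank ℂ (ker L) := by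
    rw [← Submodule.finrank_map_subtype_eq W]
    refine Submodule.finrank_mono fun u hu => ?_
    have hLu : L ⟨u, hUW hu⟩ = 0 := by
      have hB : ∀ i, B (e i) u = 0 := fun i => h.isotropic ha.1 (F.left i) hu.1
      rw [hL, hB, hB, Prod.mk_zero_zero]
    exact ⟨⟨u, hUW hu⟩, hLu, rfl⟩
  have := finrank_range_add_finrank_ker L
  rw [hrange, finrank_top, finrank_prod, finrank_self] at this
  lia

variable [FiniteDimensional ℂ S] {S₀ S₁ : Submodule ℂ S}

theorem frame_card_ne_one (h : IsSpinModule B γ N) (ha : IsPure γ N a) (hb : IsPure γ N b)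
    (hS : Disjoint S₀ S₁) (hγ : ∀ v, ∀ x ∈ S₀, γ v x ∈ S₁) (ha₀ : a ∈ S₀) (hb₀ : b ∈ S₀)
    {e f : Fin 1 → V} (F : IsFrame B γ a b e f) : False := by
  have hef : B (e 0) (f 0) = 1 := by simp [F.pairing]
  obtain ⟨t, ht⟩ := h.exists_smul_eq (y := γ (f 0) a) hb fun v hv => by
    have h1 := F.right_compl v hv
    rw [Fin.sum_univ_one, map_sub, LinearMap.sub_apply, map_smul, LinearMap.smul_apply,
      sub_eq_zero] at h1
    rw [h.swap v, h.isotropic hb.1 hv (F.right 0), h1, map_smul,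
      h.sq_eq_zero (h.isotropic hb.1 (F.right 0) (F.right 0))]
    simp
  have h0 : γ (f 0) a = 0 := Submodule.disjoint_def.1 hS _ (ht ▸ S₀.smul_mem t hb₀) (hγ _ _ ha₀)
  have h1 := h.swap (e 0) (f 0) a
  rw [h0, F.left, hef, map_zero, map_zero, one_smul, sub_zero] at h1
  exact ha.1 h1.symm

/-- Pure spinors of the same parity whose annihilators meet in codimension at most two span a line
of pure spinors. -/
theorem isPureLine_of_le (h : IsSpinModule B γ N) (ha : IsPure γ N a) (hb : IsPure γ N b)
    (hS : Disjoint S₀ S₁) (hγ : ∀ v, ∀ x ∈ S₀, γ v x ∈ S₁) (ha₀ : a ∈ S₀) (hb₀ : b ∈ S₀)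
    (hU : N ≤ finrank ℂ (spinorAnnihilator γ a ⊓ spinorAnnihilator γ b : Submodule ℂ V) + 2) :
    IsPureLine γ N a b := by
  obtain ⟨k, e, f, F, hk⟩ := h.exists_isFrame ha hb
  obtain rfl | rfl | rfl : k = 0 ∨ k = 1 ∨ k = 2 := by lia
  · obtain ⟨t, rfl⟩ := h.exists_smul_eq (y := b) ha fun v hv => by simpa using F.left_compl v hv
    exact ha.isPureLine_self.smul_right t
  · exact (h.frame_card_ne_one ha hb hS hγ ha₀ hb₀ F).elim
  · have hline := h.isPureLine_exchange ha hb F zero_ne_one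
    have hpure : IsPure γ N (γ (f 0) (γ (f 1) a)) := by
      simpa using hline 0 1 (by simpa using h.exchange_ne_zero ha F zero_ne_one)
    have hle := Submodule.eq_of_le_of_finrank_le inf_le_left
      (hpure.2.le.trans (hU.trans (h.finrank_exchange ha hb F zero_ne_one)))
    obtain ⟨t, rfl⟩ := h.exists_smul_eq (y := b) hpure (inf_eq_left.1 hle)
    exact hline.smul_right t

/-- Pure spinors of the same parity whose annihilators meet in codimension at most four are joined
by two lines of pure spinors. -/
theorem exists_isPureLine (h : IsSpinModule B γ N) (ha : IsPure γ N a) (hb : IsPure γ N b)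
    (hS : Disjoint S₀ S₁) (hγ : ∀ v, ∀ x ∈ S₀, γ v x ∈ S₁) (hγ' : ∀ v, ∀ x ∈ S₁, γ v x ∈ S₀)
    (ha₀ : a ∈ S₀) (hb₀ : b ∈ S₀)
    (hU : N ≤ finrank ℂ (spinorAnnihilator γ a ⊓ spinorAnnihilator γ b : Submodule ℂ V) + 4) :
    ∃ x ∈ S₀, IsPure γ N x ∧ IsPureLine γ N a x ∧ IsPureLine γ N x b := by
  obtain ⟨k, e, f, F, hk⟩ := h.exists_isFrame ha hb
  by_cases hk2 : k ≤ 2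
  · exact ⟨a, ha₀, ha, ha.isPureLine_self, h.isPureLine_of_le ha hb hS hγ ha₀ hb₀ (by lia)⟩
  · have hij : (⟨0, by lia⟩ : Fin k) ≠ ⟨1, by lia⟩ := by simp
    have hline := h.isPureLine_exchange ha hb F hij
    have hpure := hline 0 1 (by simpa using h.exchange_ne_zero ha F hij)
    rw [zero_smul, one_smul, zero_add] at hpure
    have hmem := hγ' (f ⟨0, by lia⟩) _ (hγ (f ⟨1, by lia⟩) _ ha₀)
    have hle := h.finrank_exchange ha hb F hij
    exact ⟨_, hmem, hpure, hline, h.isPureLine_of_le hpure hb hS hγ hmem hb₀ (by lia)⟩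

end IsSpinModule

end PureLines

end SpinModule

section Parity

variable {R M : Type*} [CommRing R] [AddCommGroup M] [Module R M] {Q : QuadraticForm R M}

theorem ι_mul_mem_evenOdd (m : M) {n : ZMod 2} {x : CliffordAlgebra Q} (hx : x ∈ evenOdd Q n) :
    ι Q m * x ∈ evenOdd Q (n + 1) := by
  rw [add_comm]
  exact evenOdd_mul_le Q 1 n (Submodule.mul_mem_mul (ι_mem_evenOdd_one Q m) hx)

theorem contractLeft_mem_evenOdd (δ : Module.Dual R M) {n : ZMod 2} {x : CliffordAlgebra Q}
    (hx : x ∈ evenOdd Q n) : contractLeft δ x ∈ evenOdd Q (n + 1) := by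
  induction x, hx using evenOdd_induction with
  | range_ι_pow x hx =>
    fin_cases n
    · obtain ⟨r, rfl⟩ := Submodule.mem_one.1 hx
      rw [contractLeft_algebraMap]
      exact zero_mem _
    · obtain ⟨m, rfl⟩ : x ∈ LinearMap.range (ι Q) := by simpa [ZMod.val] using hx
      rw [contractLeft_ι]
      exact SetLike.algebraMap_mem_graded (evenOdd Q) (δ m)
  | add x y _ _ hx hy => rw [map_add]; exact add_mem hx hy
  | ι_mul_ι_mul m₁ m₂ x hx ih =>
    rw [mul_assoc, contractLeft_ι_mul, contractLeft_ι_mul]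
    refine sub_mem (Submodule.smul_mem _ _ (ι_mul_mem_evenOdd m₂ hx)) ?_
    refine ι_mul_mem_evenOdd m₁ (sub_mem (Submodule.smul_mem _ (δ m₂) hx) ?_)
    have := ι_mul_mem_evenOdd m₂ ih
    rwa [add_assoc, CharTwo.add_self_eq_zero, add_zero] at this

end Parity

section Concrete

open Module

/-- The symmetric bilinear form on `V = E ⊕ E^∨`. -/
def hyperbolicForm (N : ℕ) : LinearMap.BilinForm ℂ (Vsp N) :=
  LinearMap.mk₂ ℂ (fun v w => ∑ i, (v.1 i * w.2 i + v.2 i * w.1 i))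
    (fun v v' w => by simp [← Finset.sum_add_distrib]; congr; ext; ring)
    (fun c v w => by simp [Finset.mul_sum]; congr; ext; ring)
    (fun v w w' => by simp [← Finset.sum_add_distrib]; congr; ext; ring)
    (fun c v w => by simp [Finset.mul_sum]; congr; ext; ring)

theorem hyperbolicForm_apply {N : ℕ} (v w : Vsp N) :
    hyperbolicForm N v w = ∑ i, (v.1 i * w.2 i + v.2 i * w.1 i) := rfl

theorem hyperbolicForm_comm {N : ℕ} (v w : Vsp N) :
    hyperbolicForm N v w = hyperbolicForm N w v := by
  simp only [hyperbolicForm_apply]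
  exact Finset.sum_congr rfl fun i _ => by ring

/-- Clifford multiplication on `⋀E`. -/
def cliffordMul (N : ℕ) : Vsp N →ₗ[ℂ] ExtE N →ₗ[ℂ] ExtE N :=
  LinearMap.mul ℂ (ExtE N) ∘ₗ ExteriorAlgebra.ι ℂ ∘ₗ LinearMap.fst ℂ _ _ +
    contractLeft (Q := (0 : QuadraticForm ℂ (Evec N))) ∘ₗ toDualMap N ∘ₗ LinearMap.snd ℂ _ _

variable {N : ℕ}

theorem cliffordMul_apply (v : Vsp N) (x : ExtE N) : cliffordMul N v x =
    ExteriorAlgebra.ι ℂ v.1 * x +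
      contractLeft (Q := (0 : QuadraticForm ℂ (Evec N))) (toDualMap N v.2) x := rfl

theorem cliffordMul_mem (v : Vsp N) {n : ZMod 2} {x : ExtE N}
    (hx : x ∈ evenOdd (0 : QuadraticForm ℂ (Evec N)) n) :
    cliffordMul N v x ∈ evenOdd (0 : QuadraticForm ℂ (Evec N)) (n + 1) :=
  add_mem (ι_mul_mem_evenOdd v.1 hx) (contractLeft_mem_evenOdd _ hx)

theorem finrank_extE : finrank ℂ (ExtE N) = 2 ^ N := by
  rw [finrank_eq_card_basis (Pi.basisFun ℂ (Fin N)).ExteriorAlgebra]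
  simp

instance : FiniteDimensional ℂ (ExtE N) :=
  Module.Basis.finiteDimensional_of_finite (Pi.basisFun ℂ (Fin N)).ExteriorAlgebra

theorem isSpinModule_cliffordMul : IsSpinModule (hyperbolicForm N) (cliffordMul N) N where
  anticomm v w x := by
    have h1 := ExteriorAlgebra.ι_add_mul_swap (R := ℂ) v.1 w.1
    have h2 : ∀ f e : Evec N, toDualMap N f e = ∑ i, f i * e i := fun f e => by
      simp [toDualMap]
    simp only [cliffordMul_apply, map_add]
    unfold ExteriorAlgebra.ι at *
    rw [contractLeft_ι_mul, contractLeft_ι_mul,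
      contractLeft_comm (toDualMap N v.2) (toDualMap N w.2), h2, h2, hyperbolicForm_apply,
      Finset.sum_add_distrib, add_smul]
    have h3 := congrArg (· * x) h1
    simp only [add_mul, zero_mul, mul_assoc] at h3
    rw [← sub_eq_zero] at h3 ⊢
    simp only [mul_comm (w.2 _)]
    rw [← h3]
    abel
  symm := hyperbolicForm_comm
  nondegenerate := by
    have hrefl : LinearMap.IsRefl (hyperbolicForm N) := fun v w hvw => by
      rw [hyperbolicForm_comm, hvw]
    refine hrefl.nondegenerate_iff_separatingLeft.2 fun v hv => ?_
    refine Prod.ext (funext fun i => ?_) (funext fun i => ?_)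
    · simpa [hyperbolicForm_apply, Pi.single_apply] using hv (0, Pi.single i 1)
    · simpa [hyperbolicForm_apply, Pi.single_apply] using hv (Pi.single i 1, 0)
  finrank_vectors := by
    rw [finrank_prod, finrank_fin_fun, two_mul]
  finrank_spinors := finrank_extE

theorem isPure_of_purespinor {a : ExtE N} (ha : purespinor a) : IsPure (cliffordMul N) N a :=
  ⟨ha.1, ha.2.2⟩

theorem lineIn_spinorVariety {a b : ExtE N} (ha : purespinor a) (hb : purespinor b)
    (h : IsPureLine (cliffordMul N) N a b) :
    lineIn (SpinorVariety N) (.mk ℂ a ha.1) (.mk ℂ b hb.1) := fun r hr => by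
  rw [Projectivization.submodule_mk, Projectivization.submodule_mk,
    Projectivization.submodule_eq, Submodule.span_singleton_le_iff_mem] at hr
  obtain ⟨_, hx, _, hy, hxy⟩ := Submodule.mem_sup.1 hr
  obtain ⟨α, rfl⟩ := Submodule.mem_span_singleton.1 hx
  obtain ⟨β, rfl⟩ := Submodule.mem_span_singleton.1 hy
  have hpure := h α β (hxy ▸ r.rep_nonzero)
  have hmem := add_mem (Submodule.smul_mem _ α ha.2.1) (Submodule.smul_mem _ β hb.2.1)
  rw [hxy] at hpure hmem
  exact ⟨r.rep, r.rep_nonzero, ⟨r.rep_nonzero, hmem, hpure.2⟩, r.mk_rep.symm⟩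

theorem hdist_le_two {a b : ExtE N} (ha : purespinor a) (hb : purespinor b)
    (hU : N ≤ finrank ℂ (spinorAnnihilator (cliffordMul N) a ⊓
      spinorAnnihilator (cliffordMul N) b : Submodule ℂ (Vsp N)) + 4) :
    hdist (SpinorVariety N) (.mk ℂ a ha.1) (.mk ℂ b hb.1) ≤ 2 := by
  obtain ⟨x, hx₀, hx, hax, hxb⟩ := isSpinModule_cliffordMul.exists_isPureLine
    (isPure_of_purespinor ha) (isPure_of_purespinor hb) (evenOdd_isCompl _).disjoint
    (fun v _ => cliffordMul_mem v) (fun v _ => cliffordMul_mem v) ha.2.1 hb.2.1 hU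
  have hx' : purespinor x := ⟨hx.1, hx₀, hx.2⟩
  refine Nat.sInf_le ⟨fun | 0 => .mk ℂ a ha.1 | 1 => .mk ℂ x hx.1 | _ => .mk ℂ b hb.1,
    rfl, rfl, fun i hi => ?_, fun i hi => ?_⟩
  · interval_cases i
    exacts [⟨a, ha.1, ha, rfl⟩, ⟨x, hx.1, hx', rfl⟩, ⟨b, hb.1, hb, rfl⟩]
  · interval_cases i
    exacts [lineIn_spinorVariety ha hx' hax, lineIn_spinorVariety hx' hb hxb]

end Concrete

/-- For `N` even, `N ≥ 6` and `3 ≤ l ≤ N/2`, every point of the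
secant orbit `Σ_{l,N}` is identifiable: any decomposition of a sum of two pure spinors
at Hamming distance `l` as a sum of two pure spinors coincides with the given one. -/
theorem stmt17 (N l : ℕ) (hN : Even N) (h6 : 6 ≤ N) (hl : 3 ≤ l) (h2l : 2 * l ≤ N)
    (a b c d : ExtE N) (ha : purespinor a) (hb : purespinor b)
    (hc : purespinor c) (hd : purespinor d)
    (hab : hdist (SpinorVariety N) (Projectivization.mk ℂ a ha.1)
      (Projectivization.mk ℂ b hb.1) = l)
    (hsum : a + b = c + d) :
    (c = a ∧ d = b) ∨ (c = b ∧ d = a) := by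
  refine isSpinModule_cliffordMul.identifiable (isPure_of_purespinor ha) (isPure_of_purespinor hb)
    (isPure_of_purespinor hc) (isPure_of_purespinor hd) ?_ hsum
  by_contra hU
  have := hdist_le_two ha hb (by lia)
  lia
end
end
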